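/- Let P_1, …, P_m be a Clifford system of signature (m, r) on ℝ^{2l}_s with m ≡ 0 (mod 4), r ≡ 0 (mod 2), s ≤ 2l − 1, and l > m. Then each connected component L of the focal variety M_+ is inhomogeneous: there is no subgroup K of the pseudo-orthogonal group O(s, 2l−s) which leaves L invariant and acts transitively on L. -/

import Mathlib

open Matrix

noncomputable section

/-- Entries of the signature matrix `J_{r,m-r}`, with 1-based indices:
`η_{ii} = -1` for `1 ≤ i ≤ r` and `η_{ii} = 1` for `r < i`; off-diagonal entries vanish. -/
def cliffEta (r i j : ℕ) : ℝ :=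
  if i = j then (if i ≤ r then -1 else 1) else 0

/-- The matrix `J_{s,n-s} = diag(-E_s, E_{n-s})`. -/
def psJ (n s : ℕ) : Matrix (Fin n) (Fin n) ℝ :=
  Matrix.diagonal fun i => if (i : ℕ) < s then (-1 : ℝ) else 1

/-- The pseudo-inner product `⟨u, v⟩ = uᵀ J_{s,n-s} v` of `ℝ^n_s`. -/
def psInner (n s : ℕ) (u v : Fin n → ℝ) : ℝ :=
  u ⬝ᵥ ((psJ n s) *ᵥ v)

/-- A Clifford system of signature `(m, r)` on `ℝ^{2l}_s`, indexed by `1, …, m`: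
each `P i` is symmetric with respect to the pseudo-inner product, and
`P i * P j + P j * P i = 2 η_{ij} E_{2l}`. -/
def IsCliffordSystem (l s m r : ℕ)
    (P : ℕ → Matrix (Fin (2 * l)) (Fin (2 * l)) ℝ) : Prop :=
  (∀ i ∈ Finset.Icc 1 m, (P i)ᵀ = psJ (2 * l) s * P i * psJ (2 * l) s) ∧
  (∀ i ∈ Finset.Icc 1 m, ∀ j ∈ Finset.Icc 1 m,
    P i * P j + P j * P i
      = (2 * cliffEta r i j) • (1 : Matrix (Fin (2 * l)) (Fin (2 * l)) ℝ))

/-- A subset `L ⊆ ℝ^n_s` is homogeneous if some subgroup `K` of the pseudo-orthogonal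
group `O(s, n-s)` leaves `L` invariant and acts transitively on `L`. -/
def IsHomogeneousIn (n s : ℕ) (L : Set (Fin n → ℝ)) : Prop :=
  ∃ K : Set (Matrix (Fin n) (Fin n) ℝ),
    (∀ A ∈ K, Aᵀ * psJ n s * A = psJ n s) ∧
    (1 : Matrix (Fin n) (Fin n) ℝ) ∈ K ∧
    (∀ A ∈ K, ∀ B ∈ K, A * B ∈ K) ∧
    (∀ A ∈ K, ∃ B ∈ K, A * B = 1 ∧ B * A = 1) ∧
    (∀ A ∈ K, ∀ x ∈ L, A *ᵥ x ∈ L) ∧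
    (∀ x ∈ L, ∀ y ∈ L, ∃ A ∈ K, A *ᵥ x = y)


/-- the bilinear form `uᵀ J v`. -/
def bB {n : ℕ} (J : Matrix (Fin n) (Fin n) ℝ) :
    (Fin n → ℝ) →ₗ[ℝ] (Fin n → ℝ) →ₗ[ℝ] ℝ := Matrix.toLinearMap₂' ℝ J

/-- A Clifford system indexed by `Fin m`. -/
structure CS {n m : ℕ} (J : Matrix (Fin n) (Fin n) ℝ)
    (p : Fin m → Matrix (Fin n) (Fin n) ℝ) (η : Fin m → ℝ) : Prop where
  JJ : J * J = 1
  JT : Jᵀ = J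
  ee : ∀ i, η i * η i = 1
  sym : ∀ i, (p i)ᵀ * J = J * p i
  sq : ∀ i, p i * p i = η i • 1
  ac : ∀ i j, i ≠ j → p i * p j = - (p j * p i)

/-- Linear combinations of the Clifford system. -/
def pc {n m : ℕ} (p : Fin m → Matrix (Fin n) (Fin n) ℝ) (c : Fin m → ℝ) :
    Matrix (Fin n) (Fin n) ℝ := ∑ j, c j • p j

lemma bB_apply {n : ℕ} (J : Matrix (Fin n) (Fin n) ℝ) (u v : Fin n → ℝ) :
    bB J u v = u ⬝ᵥ (J *ᵥ v) := Matrix.toLinearMap₂'_apply' ..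

lemma bB_adj {n : ℕ} {J X : Matrix (Fin n) (Fin n) ℝ} (h : Xᵀ * J = J * X) (u v : Fin n → ℝ) :
    bB J (X *ᵥ u) v = bB J u (X *ᵥ v) := by
  rw [bB_apply, bB_apply, Matrix.mulVec_mulVec, ← h, ← Matrix.mulVec_mulVec,
    Matrix.dotProduct_mulVec u, Matrix.vecMul_transpose]

lemma bB_symm {n : ℕ} {J : Matrix (Fin n) (Fin n) ℝ} (h : Jᵀ = J) (u v : Fin n → ℝ) :
    bB J u v = bB J v u := by
  rw [bB_apply, bB_apply, Matrix.dotProduct_mulVec, ← Matrix.mulVec_transpose, h,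
    dotProduct_comm]

lemma bB_nondeg {n : ℕ} {J : Matrix (Fin n) (Fin n) ℝ} (hJ : J * J = 1) (u : Fin n → ℝ)
    (h : ∀ v, bB J u v = 0) : u = 0 := by
  have h1 := h (J *ᵥ u)
  rw [bB_apply, Matrix.mulVec_mulVec, hJ, Matrix.one_mulVec] at h1
  exact dotProduct_self_eq_zero.1 h1

section CSsec

variable {n m : ℕ} {J : Matrix (Fin n) (Fin n) ℝ}
    {p : Fin m → Matrix (Fin n) (Fin n) ℝ} {η : Fin m → ℝ}

lemma pc_mulVec (c : Fin m → ℝ) (x : Fin n → ℝ) : pc p c *ᵥ x = ∑ j, c j • (p j *ᵥ x) := by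
  simp [pc, Matrix.sum_mulVec, Matrix.smul_mulVec]

lemma CS.psym (h : CS J p η) (c : Fin m → ℝ) : (pc p c)ᵀ * J = J * pc p c := by
  simp [pc, Matrix.transpose_sum, Finset.sum_mul, Finset.mul_sum, h.sym]

lemma CS.orth (h : CS J p η) (x : Fin n → ℝ) (i j : Fin m) :
    bB J (p i *ᵥ x) (p j *ᵥ x) = if i = j then η i * bB J x x else 0 := by
  split_ifs with hij
  · subst hij
    rw [bB_adj (h.sym i), Matrix.mulVec_mulVec, h.sq, Matrix.smul_mulVec, Matrix.one_mulVec]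
    simp
  · have h1 : bB J (p i *ᵥ x) (p j *ᵥ x) = - bB J (p j *ᵥ x) (p i *ᵥ x) := by
      rw [bB_adj (h.sym i), bB_adj (h.sym j), Matrix.mulVec_mulVec, Matrix.mulVec_mulVec,
        h.ac i j hij, Matrix.neg_mulVec, map_neg]
    have h2 := bB_symm h.JT (p i *ᵥ x) (p j *ᵥ x)
    linarith

lemma CS.orth_pc (h : CS J p η) (x : Fin n → ℝ) (i : Fin m) (c : Fin m → ℝ) :
    bB J (p i *ᵥ x) (pc p c *ᵥ x) = η i * c i * bB J x x := by
  simp only [pc_mulVec, map_sum, map_smul, h.orth, smul_eq_mul]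
  rw [Finset.sum_eq_single i]
  · simp; ring
  · intro b _ hb; simp [hb.symm]
  · simp

/-- the square of a vector. -/
def nsq (η c : Fin m → ℝ) : ℝ := ∑ j, η j * c j ^ 2

lemma CS.pc_pc_vec (h : CS J p η) (x : Fin n → ℝ) (c : Fin m → ℝ) :
    bB J (pc p c *ᵥ x) (pc p c *ᵥ x) = nsq η c * bB J x x := by
  have key : ∀ w, bB J (pc p c *ᵥ x) w = ∑ j, c j * bB J (p j *ᵥ x) w := by
    intro w; simp [pc_mulVec]
  rw [key, nsq, Finset.sum_mul]
  refine Finset.sum_congr rfl fun j _ => ?_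
  rw [h.orth_pc]; ring

lemma CS.anti (h : CS J p η) (i : Fin m) (c : Fin m → ℝ) :
    p i * pc p c = - (pc p c * p i) + (2 * η i * c i) • 1 := by
  have : p i * pc p c + pc p c * p i = (2 * η i * c i) • 1 := by
    rw [pc, Finset.mul_sum, Finset.sum_mul, ← Finset.sum_add_distrib, Finset.sum_eq_single i]
    · rw [mul_smul_comm, smul_mul_assoc, h.sq, smul_smul, ← add_smul]; congr 1; ring
    · intro b _ hb
      rw [mul_smul_comm, smul_mul_assoc, h.ac i b hb.symm, smul_neg, neg_add_cancel]
    · simp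
  rw [← this]; abel

lemma CS.pc_sq (h : CS J p η) (c : Fin m → ℝ) : pc p c * pc p c = nsq η c • 1 := by
  have h1 : pc p c * pc p c = ∑ i, c i • (p i * pc p c) := by
    conv_lhs => lhs; rw [pc]
    rw [Finset.sum_mul]; simp
  have h2 : pc p c * pc p c = ∑ i, c i • (pc p c * p i) := by
    conv_lhs => rhs; rw [pc]
    rw [Finset.mul_sum]; simp
  have h3 : pc p c * pc p c + pc p c * pc p c = nsq η c • 1 + nsq η c • 1 := by
    nth_rewrite 1 [h1]
    rw [h2, ← Finset.sum_add_distrib, ← add_smul, nsq, ← Finset.sum_add_distrib, Finset.sum_smul]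
    refine Finset.sum_congr rfl fun j _ => ?_
    rw [h.anti, ← smul_add, neg_add_cancel_comm, smul_smul]; congr 1; ring
  have h4 : (2:ℝ) • (pc p c * pc p c) = (2:ℝ) • (nsq η c • (1 : Matrix (Fin n) (Fin n) ℝ)) := by
    rw [two_smul, two_smul, h3]
  exact smul_right_injective _ (two_ne_zero (α := ℝ)) h4

/-- value of the forms at `α x + P_c x`. -/
lemma CS.val (h : CS J p η) (x : Fin n → ℝ) (hx : ∀ j, bB J (p j *ᵥ x) x = 0)
    (hx1 : bB J x x = 1) (a : ℝ) (c : Fin m → ℝ) (j : Fin m) :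
    bB J (p j *ᵥ (a • x + pc p c *ᵥ x)) (a • x + pc p c *ᵥ x) = 2 * a * (η j * c j) := by
  have hc : bB J (pc p c *ᵥ x) x = 0 := by
    rw [pc_mulVec]; simp [hx]
  have h1 : bB J (p j *ᵥ (pc p c *ᵥ x)) (pc p c *ᵥ x) = 0 := by
    rw [Matrix.mulVec_mulVec, h.anti, Matrix.add_mulVec, Matrix.neg_mulVec, Matrix.smul_mulVec,
      Matrix.one_mulVec, map_add, LinearMap.add_apply, map_neg, LinearMap.neg_apply, map_smul,
      LinearMap.smul_apply, ← Matrix.mulVec_mulVec, bB_adj (h.psym c), Matrix.mulVec_mulVec,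
      h.pc_sq, Matrix.smul_mulVec, Matrix.one_mulVec, map_smul, hx, bB_symm h.JT x, hc]
    simp
  have h2 := h.orth_pc x j c
  have h3 : bB J (p j *ᵥ (pc p c *ᵥ x)) x = η j * c j := by
    rw [bB_adj (h.sym j), bB_symm h.JT, h2, hx1, mul_one]
  simp only [Matrix.mulVec_add, Matrix.mulVec_smul, map_add, map_smul, LinearMap.add_apply,
    LinearMap.smul_apply, smul_eq_mul, h1, h2, h3, hx, hx1]
  ring

/-- the quartic form. -/
def qH (J : Matrix (Fin n) (Fin n) ℝ) (p : Fin m → Matrix (Fin n) (Fin n) ℝ) (η : Fin m → ℝ)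
    (y : Fin n → ℝ) : ℝ := ∑ j, η j * (bB J (p j *ᵥ y) y) ^ 2

lemma CS.Hval (h : CS J p η) (x : Fin n → ℝ) (hx : ∀ j, bB J (p j *ᵥ x) x = 0)
    (hx1 : bB J x x = 1) (a : ℝ) (c : Fin m → ℝ) :
    qH J p η (a • x + pc p c *ᵥ x) = 4 * a ^ 2 * bB J (pc p c *ᵥ x) (pc p c *ᵥ x) := by
  rw [h.pc_pc_vec, hx1, qH, nsq, mul_one, Finset.mul_sum]
  refine Finset.sum_congr rfl fun j _ => ?_
  rw [h.val x hx hx1]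
  have := h.ee j
  linear_combination 4 * a ^ 2 * c j ^ 2 * η j * this

end CSsec


section Ret

variable {n m : ℕ} {J : Matrix (Fin n) (Fin n) ℝ}
    {p : Fin m → Matrix (Fin n) (Fin n) ℝ} {η : Fin m → ℝ}

/-- discriminant square root -/
def rs (J : Matrix (Fin n) (Fin n) ℝ) (p : Fin m → Matrix (Fin n) (Fin n) ℝ) (η : Fin m → ℝ)
    (y : Fin n → ℝ) : ℝ := Real.sqrt ((bB J y y) ^ 2 - qH J p η y)

/-- first coefficient -/
def ra (J : Matrix (Fin n) (Fin n) ℝ) (p : Fin m → Matrix (Fin n) (Fin n) ℝ) (η : Fin m → ℝ)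
    (y : Fin n → ℝ) : ℝ := Real.sqrt ((bB J y y + rs J p η y) / 2)

/-- normal coefficients -/
def rc (J : Matrix (Fin n) (Fin n) ℝ) (p : Fin m → Matrix (Fin n) (Fin n) ℝ) (η : Fin m → ℝ)
    (y : Fin n → ℝ) (j : Fin m) : ℝ := η j * bB J (p j *ᵥ y) y / (2 * ra J p η y)

/-- the retraction onto the focal variety -/
def ret (J : Matrix (Fin n) (Fin n) ℝ) (p : Fin m → Matrix (Fin n) (Fin n) ℝ) (η : Fin m → ℝ)
    (y : Fin n → ℝ) : Fin n → ℝ :=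
  (rs J p η y)⁻¹ • (ra J p η y • y - pc p (rc J p η y) *ᵥ y)

/-- domain of the retraction -/
def rU (J : Matrix (Fin n) (Fin n) ℝ) (p : Fin m → Matrix (Fin n) (Fin n) ℝ) (η : Fin m → ℝ) :
    Set (Fin n → ℝ) := {y | 0 < bB J y y ∧ 0 < (bB J y y) ^ 2 - qH J p η y}

/-- the focal variety -/
def Mset (J : Matrix (Fin n) (Fin n) ℝ) (p : Fin m → Matrix (Fin n) (Fin n) ℝ) :
    Set (Fin n → ℝ) := {x | bB J x x = 1 ∧ ∀ j, bB J (p j *ᵥ x) x = 0}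

lemma ret_pos {y : Fin n → ℝ} (hy : y ∈ rU J p η) : 0 < rs J p η y ∧ 0 < ra J p η y := by
  have h1 : 0 < rs J p η y := Real.sqrt_pos.2 hy.2
  refine ⟨h1, Real.sqrt_pos.2 ?_⟩
  have := hy.1
  positivity

lemma CS.ret_nsq (h : CS J p η) {y : Fin n → ℝ} (hy : y ∈ rU J p η) :
    ra J p η y ^ 2 = (bB J y y + rs J p η y) / 2 ∧
    nsq η (rc J p η y) = (bB J y y - rs J p η y) / 2 := by
  obtain ⟨h1, h2⟩ := ret_pos hy
  have hs : rs J p η y ^ 2 = (bB J y y) ^ 2 - qH J p η y := Real.sq_sqrt hy.2.le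
  have ha : ra J p η y ^ 2 = (bB J y y + rs J p η y) / 2 := by
    refine Real.sq_sqrt ?_
    have := hy.1
    positivity
  refine ⟨ha, ?_⟩
  have h3 : nsq η (rc J p η y) * (4 * ra J p η y ^ 2) = qH J p η y := by
    rw [nsq, qH, Finset.sum_mul]
    refine Finset.sum_congr rfl fun j _ => ?_
    rw [rc]
    have := h.ee j
    field_simp
    linear_combination 4 * (bB J (p j *ᵥ y) y) ^ 2 * η j * this
  have h4 : 0 < 4 * ra J p η y ^ 2 := by positivity
  apply mul_right_cancel₀ h4.ne'
  rw [h3, ha]; linear_combination hs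

lemma CS.ret_eq (h : CS J p η) {y : Fin n → ℝ} (hy : y ∈ rU J p η) :
    ra J p η y • ret J p η y + pc p (rc J p η y) *ᵥ ret J p η y = y := by
  obtain ⟨h1, h2⟩ := ret_pos hy
  obtain ⟨h3, h4⟩ := h.ret_nsq hy
  rw [ret, Matrix.mulVec_smul, Matrix.mulVec_sub, Matrix.mulVec_smul, Matrix.mulVec_mulVec,
    h.pc_sq, Matrix.smul_mulVec, Matrix.one_mulVec, h4]
  have : ra J p η y * ra J p η y - (bB J y y - rs J p η y) / 2 = rs J p η y := by
    rw [← pow_two, h3]; ring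
  have h5 : ra J p η y • (rs J p η y)⁻¹ • (ra J p η y • y - pc p (rc J p η y) *ᵥ y) +
    (rs J p η y)⁻¹ • (ra J p η y • pc p (rc J p η y) *ᵥ y - ((bB J y y - rs J p η y) / 2) • y)
     = ((rs J p η y)⁻¹ * (ra J p η y * ra J p η y - (bB J y y - rs J p η y) / 2)) • y := by
    module
  rw [h5, this, inv_mul_cancel₀ h1.ne', one_smul]

lemma CS.ret_mem (h : CS J p η) {y : Fin n → ℝ} (hy : y ∈ rU J p η) :
    ret J p η y ∈ Mset J p := by
  obtain ⟨h1, h2⟩ := ret_pos hy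
  obtain ⟨h3, h4⟩ := h.ret_nsq hy
  set s := rs J p η y
  set a := ra J p η y
  set c := rc J p η y with hc
  have hb : ∀ j, bB J (p j *ᵥ y) y = 2 * a * (η j * c j) := by
    intro j
    have := h.ee j
    simp only [hc, rc]
    change _ = 2 * a * (η j * (η j * bB J (p j *ᵥ y) y / (2 * a)))
    field_simp
    linear_combination (- bB J (p j *ᵥ y) y) * this
  have hcc : bB J (pc p c *ᵥ y) y = 2 * a * nsq η c := by
    rw [pc_mulVec, nsq, Finset.mul_sum]
    simp only [map_sum, LinearMap.sum_apply, map_smul, LinearMap.smul_apply, hb, smul_eq_mul]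
    exact Finset.sum_congr rfl fun j _ => by ring
  have hcc' : bB J y (pc p c *ᵥ y) = 2 * a * nsq η c := by rw [bB_symm h.JT, hcc]
  have hcy := h.pc_pc_vec y c
  constructor
  · change bB J (s⁻¹ • (a • y - pc p c *ᵥ y)) (s⁻¹ • (a • y - pc p c *ᵥ y)) = 1
    simp only [map_smul, LinearMap.smul_apply, map_sub, LinearMap.sub_apply, smul_eq_mul, hcy,
      hcc, hcc', h4]
    field_simp
    linear_combination 2 * (bB J y y - 2 * (bB J y y - s)) * h3
  · intro j
    change bB J (p j *ᵥ (s⁻¹ • (a • y - pc p c *ᵥ y))) (s⁻¹ • (a • y - pc p c *ᵥ y)) = 0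
    have e1 := h.orth_pc y j c
    have e2 : bB J (p j *ᵥ (pc p c *ᵥ y)) y = η j * c j * bB J y y := by
      rw [bB_adj (h.sym j), bB_symm h.JT, e1]
    have e3 : bB J (p j *ᵥ (pc p c *ᵥ y)) (pc p c *ᵥ y) =
        2 * a * (η j * c j) * nsq η c := by
      rw [Matrix.mulVec_mulVec, h.anti, Matrix.add_mulVec, Matrix.neg_mulVec, Matrix.smul_mulVec,
        Matrix.one_mulVec, map_add, LinearMap.add_apply, map_neg, LinearMap.neg_apply, map_smul,
        LinearMap.smul_apply, ← Matrix.mulVec_mulVec, bB_adj (h.psym c), Matrix.mulVec_mulVec,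
        h.pc_sq, Matrix.smul_mulVec, Matrix.one_mulVec, map_smul, hb, hcc']
      simp only [smul_eq_mul]; ring
    simp only [Matrix.mulVec_smul, Matrix.mulVec_sub, map_smul, LinearMap.smul_apply, map_sub,
      LinearMap.sub_apply, smul_eq_mul, e1, e2, e3, hb, h4]
    linear_combination (s⁻¹ * s⁻¹ * 2 * a * η j * c j) * h3

lemma ret_self {x : Fin n → ℝ} (hx : x ∈ Mset J p) : x ∈ rU J p η ∧ ret J p η x = x := by
  have hq : qH J p η x = 0 := by simp [qH, hx.2]
  have hs : rs J p η x = 1 := by simp [rs, hq, hx.1]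
  have ha : ra J p η x = 1 := by simp [ra, hs, hx.1]
  refine ⟨⟨by rw [hx.1]; norm_num, by rw [hx.1, hq]; norm_num⟩, ?_⟩
  have hc : rc J p η x = 0 := by ext j; simp [rc, hx.2]
  simp [ret, hs, ha, hc, pc]

lemma cont_bB (X : Matrix (Fin n) (Fin n) ℝ) : Continuous fun y => bB J (X *ᵥ y) y := by
  simp only [bB_apply]
  fun_prop

lemma cont_bB' : Continuous fun y => bB J y y := by
  simpa using cont_bB (J := J) 1

lemma cont_qH : Continuous (qH J p η) := by
  unfold qH
  have := fun j => cont_bB (J := J) (p j)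
  fun_prop

lemma cont_rs : Continuous (rs J p η) := by
  unfold rs
  have := cont_qH (J := J) (p := p) (η := η)
  have := cont_bB' (J := J)
  fun_prop

lemma cont_ra : Continuous (ra J p η) := by
  unfold ra
  have := cont_rs (J := J) (p := p) (η := η)
  have := cont_bB' (J := J)
  fun_prop

lemma contOn_ret : ContinuousOn (ret J p η) (rU J p η) := by
  unfold ret
  refine ContinuousOn.smul (cont_rs.continuousOn.inv₀ fun y hy => (ret_pos hy).1.ne') ?_
  refine ContinuousOn.sub (cont_ra.continuousOn.smul continuousOn_id) ?_
  simp only [pc_mulVec]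
  refine continuousOn_finsetSum _ fun j _ => ?_
  have hp : ContinuousOn (fun y : Fin n → ℝ => p j *ᵥ y) (rU J p η) := by fun_prop
  have hq : ContinuousOn (fun y : Fin n → ℝ => rc J p η y j) (rU J p η) := by
    refine ContinuousOn.div ?_ (continuous_const.mul cont_ra).continuousOn
      fun y hy => (by have := (ret_pos hy).2; positivity)
    exact (continuous_const.mul (cont_bB (p j))).continuousOn
  exact hq.smul hp

lemma CS.ret_near (h : CS J p η) {x : Fin n → ℝ} (hx : x ∈ Mset J p) :
    ∀ᶠ y in nhds x, y ∈ rU J p η ∧ ret J p η y ∈ connectedComponentIn (Mset J p) x := by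
  have hU : IsOpen (rU J p η) := by
    have h2 : IsOpen {y | 0 < (bB J y y) ^ 2 - qH J p η y} := isOpen_lt continuous_const ?_
    · exact IsOpen.inter (isOpen_lt continuous_const cont_bB') h2
    exact (cont_bB'.pow 2).sub cont_qH
  obtain ⟨ε, hε, hb⟩ := Metric.isOpen_iff.1 hU x (ret_self hx).1
  have hsub : ret J p η '' Metric.ball x ε ⊆ connectedComponentIn (Mset J p) x := by
    refine IsPreconnected.subset_connectedComponentIn ?_ ?_ ?_
    · exact ((convex_ball x ε).isPreconnected).image _ (contOn_ret.mono hb)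
    · exact ⟨x, Metric.mem_ball_self hε, (ret_self hx).2⟩
    · rintro _ ⟨y, hy, rfl⟩
      exact h.ret_mem (hb hy)
  filter_upwards [Metric.ball_mem_nhds x hε] with y hy
  exact ⟨hb hy, hsub ⟨y, hy, rfl⟩⟩

lemma CS.ret_deriv (h : CS J p η) {x v : Fin n → ℝ} (hx : x ∈ Mset J p)
    (hv : bB J x v = 0) (hv' : ∀ j, bB J (p j *ᵥ x) v = 0) :
    HasDerivAt (fun t : ℝ => ret J p η (x + t • v)) v 0 := by
  have e1 : ∀ t : ℝ, bB J (x + t • v) (x + t • v) = 1 + t ^ 2 * bB J v v := by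
    intro t
    have := bB_symm h.JT v x
    simp only [map_add, map_smul, LinearMap.add_apply, LinearMap.smul_apply, smul_eq_mul, hx.1,
      this, hv]
    ring
  have e2 : ∀ (t : ℝ) j, bB J (p j *ᵥ (x + t • v)) (x + t • v) = t ^ 2 * bB J (p j *ᵥ v) v := by
    intro t j
    have : bB J (p j *ᵥ v) x = 0 := by rw [bB_adj (h.sym j), bB_symm h.JT, hv']
    simp only [Matrix.mulVec_add, Matrix.mulVec_smul, map_add, map_smul, LinearMap.add_apply,
      LinearMap.smul_apply, smul_eq_mul, hx.2, this, hv']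
    ring
  have e3 : ∀ t : ℝ, qH J p η (x + t • v) = t ^ 4 * qH J p η v := by
    intro t
    simp only [qH, e2, Finset.mul_sum]
    exact Finset.sum_congr rfl fun j _ => by ring
  have hs0 : rs J p η (x + (0:ℝ) • v) = 1 := by rw [rs, e1, e3]; simp
  have ha0 : ra J p η (x + (0:ℝ) • v) = 1 := by rw [ra, e1, hs0]; simp
  have ds : HasDerivAt (fun t : ℝ => rs J p η (x + t • v)) 0 0 := by
    simp only [rs, e1, e3]
    have : HasDerivAt (fun t : ℝ => (1 + t ^ 2 * bB J v v) ^ 2 - t ^ 4 * qH J p η v) 0 0 := by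
      have := ((((hasDerivAt_id (0:ℝ)).pow 2).mul_const (bB J v v)).const_add 1).pow 2 |>.sub
        (((hasDerivAt_id (0:ℝ)).pow 4).mul_const (qH J p η v))
      exact this.congr_deriv (by simp)
    simpa using this.sqrt (by simp)
  have da : HasDerivAt (fun t : ℝ => ra J p η (x + t • v)) 0 0 := by
    simp only [ra, e1]
    have : HasDerivAt (fun t : ℝ => (1 + t ^ 2 * bB J v v + rs J p η (x + t • v)) / 2) 0 0 := by
      have := (((((hasDerivAt_id (0:ℝ)).pow 2).mul_const (bB J v v)).const_add 1).add ds).div_const 2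
      simpa using this
    simpa using this.sqrt (by simp [rs, hx.1, show qH J p η x = 0 by simp [qH, hx.2]])
  have dy : HasDerivAt (fun t : ℝ => x + t • v) v 0 := by
    simpa using ((hasDerivAt_id (0:ℝ)).smul_const v).const_add x
  have dc : ∀ j, HasDerivAt (fun t : ℝ => rc J p η (x + t • v) j) 0 0 := by
    intro j
    simp only [rc, e2]
    have h1 : HasDerivAt (fun t : ℝ => η j * (t ^ 2 * bB J (p j *ᵥ v) v)) 0 0 := by
      simpa using (((hasDerivAt_id (0:ℝ)).pow 2).mul_const (bB J (p j *ᵥ v) v)).const_mul (η j)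
    have h2 := h1.div (da.const_mul 2) (by rw [ha0]; norm_num)
    exact h2.congr_deriv (by simp)
  have hc0 : ∀ j, rc J p η (x + (0:ℝ) • v) j = 0 := by intro j; simp [rc, hx.2]
  have dp : HasDerivAt (fun t : ℝ => pc p (rc J p η (x + t • v)) *ᵥ (x + t • v)) 0 0 := by
    simp only [pc_mulVec]
    have : ∀ j ∈ (Finset.univ : Finset (Fin m)), HasDerivAt
        (fun t : ℝ => rc J p η (x + t • v) j • (p j *ᵥ (x + t • v))) 0 0 := by
      intro j _
      have d1 : HasDerivAt (fun t : ℝ => p j *ᵥ (x + t • v)) (p j *ᵥ v) 0 := by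
        simp only [Matrix.mulVec_add, Matrix.mulVec_smul]
        simpa using ((hasDerivAt_id (0:ℝ)).smul_const (p j *ᵥ v)).const_add (p j *ᵥ x)
      have := (dc j).smul d1
      rw [hc0] at this
      exact this.congr_deriv (by simp)
    simpa using HasDerivAt.fun_sum this
  have := (ds.inv (by rw [hs0]; norm_num)).smul ((da.smul dy).sub dp)
  refine this.congr_deriv ?_
  have hs1 : rs J p η x = 1 := by simpa using hs0
  have ha1 : ra J p η x = 1 := by simpa using ha0
  simp [hs1, ha1]

end Ret


section Inv

variable {n m : ℕ} {J : Matrix (Fin n) (Fin n) ℝ}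
    {p : Fin m → Matrix (Fin n) (Fin n) ℝ} {η : Fin m → ℝ}

lemma mem_L {x0 x : Fin n → ℝ} (hx : x ∈ connectedComponentIn (Mset J p) x0) : x ∈ Mset J p :=
  connectedComponentIn_subset _ _ hx

/-- tangential curves inside a component -/
lemma CS.curve (h : CS J p η) {x0 x v : Fin n → ℝ}
    (hx : x ∈ connectedComponentIn (Mset J p) x0)
    (hv : bB J x v = 0) (hv' : ∀ j, bB J (p j *ᵥ x) v = 0) :
    ∃ γ : ℝ → (Fin n → ℝ), γ 0 = x ∧ HasDerivAt γ v 0 ∧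
      ∀ᶠ t in nhds (0:ℝ), γ t ∈ connectedComponentIn (Mset J p) x0 := by
  refine ⟨fun t => ret J p η (x + t • v), ?_, h.ret_deriv (mem_L hx) hv hv', ?_⟩
  · simpa using (ret_self (mem_L hx)).2
  · have h1 := h.ret_near (mem_L hx)
    rw [← connectedComponentIn_eq hx] at h1
    have h2 : Filter.Tendsto (fun t : ℝ => x + t • v) (nhds 0) (nhds x) := by
      have : Continuous (fun t : ℝ => x + t • v) := by fun_prop
      simpa using this.tendsto 0
    exact (h2.eventually h1).mono fun t ht => ht.2

lemma CS.tangent (h : CS J p η) {R : Matrix (Fin n) (Fin n) ℝ} (hRs : Rᵀ * J = J * R)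
    {x0 x v : Fin n → ℝ}
    (hR : ∀ y ∈ connectedComponentIn (Mset J p) x0, bB J (R *ᵥ y) y = 0)
    (hx : x ∈ connectedComponentIn (Mset J p) x0)
    (hv : bB J x v = 0) (hv' : ∀ j, bB J (p j *ᵥ x) v = 0) : bB J (R *ᵥ x) v = 0 := by
  obtain ⟨γ, h0, hd, he⟩ := h.curve hx hv hv'
  let φ : (Fin n → ℝ) →L[ℝ] (Fin n → ℝ) →L[ℝ] ℝ :=
    ((bB J).comp (Matrix.toLin' R)).toContinuousBilinearMap
  have hφ : ∀ a b, φ a b = bB J (R *ᵥ a) b := fun a b => by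
    simp [φ]
  have h1 := (φ.hasFDerivAt.comp_hasDerivAt (0:ℝ) hd).clm_apply hd
  have h2 : HasDerivAt (fun t => φ (γ t) (γ t)) 0 0 := by
    have hc : HasDerivAt (fun _ : ℝ => (0:ℝ)) 0 0 := hasDerivAt_const _ _
    refine hc.congr_of_eventuallyEq ?_
    filter_upwards [he] with t ht
    rw [hφ]; exact hR _ ht
  have h3 := h1.unique h2
  simp only [Function.comp_apply, h0, hφ] at h3
  rw [bB_adj hRs v x, bB_symm h.JT v] at h3
  linarith

lemma CS.normal (h : CS J p η) {R : Matrix (Fin n) (Fin n) ℝ} (hRs : Rᵀ * J = J * R)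
    {x0 x : Fin n → ℝ}
    (hR : ∀ y ∈ connectedComponentIn (Mset J p) x0, bB J (R *ᵥ y) y = 0)
    (hx : x ∈ connectedComponentIn (Mset J p) x0) :
    R *ᵥ x = pc p (fun j => η j * bB J (p j *ᵥ x) (R *ᵥ x)) *ᵥ x := by
  have hm := mem_L hx
  set a : Fin m → ℝ := fun j => η j * bB J (p j *ᵥ x) (R *ᵥ x) with ha
  have hxp : ∀ c, bB J x (pc p c *ᵥ x) = 0 := by
    intro c
    rw [bB_symm h.JT, pc_mulVec]; simp [hm.2]
  have key : ∀ j, bB J (R *ᵥ x - pc p a *ᵥ x) (p j *ᵥ x) = 0 := by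
    intro j
    rw [map_sub, LinearMap.sub_apply, bB_symm h.JT (pc p a *ᵥ x), h.orth_pc, hm.1,
      bB_symm h.JT (R *ᵥ x)]
    have := h.ee j
    simp only [ha]
    linear_combination (-bB J (p j *ᵥ x) (R *ᵥ x)) * this
  have key2 : bB J (R *ᵥ x - pc p a *ᵥ x) x = 0 := by
    rw [map_sub, LinearMap.sub_apply, hR x hx, bB_symm h.JT, hxp, sub_zero]
  rw [← sub_eq_zero]
  refine bB_nondeg h.JJ _ fun u => ?_
  set d : Fin m → ℝ := fun j => η j * bB J (p j *ᵥ x) u with hd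
  set v := u - bB J x u • x - pc p d *ᵥ x with hv
  have h1 : bB J x v = 0 := by
    simp [hv, hxp, hm.1]
  have h2 : ∀ j, bB J (p j *ᵥ x) v = 0 := by
    intro j
    have := h.ee j
    simp only [hv, map_sub, map_smul, hm.2, h.orth_pc, hm.1, hd, smul_zero]
    linear_combination (-bB J (p j *ᵥ x) u) * this
  have h3 := h.tangent hRs hR hx h1 h2
  have h4 : bB J (pc p a *ᵥ x) v = 0 := by
    rw [pc_mulVec]; simp [h2]
  have hu : u = v + bB J x u • x + pc p d *ᵥ x := by rw [hv]; abel
  have h5 : bB J (R *ᵥ x - pc p a *ᵥ x) (pc p d *ᵥ x) = 0 := by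
    rw [pc_mulVec d, map_sum]
    exact Finset.sum_eq_zero fun j _ => by rw [map_smul, key, smul_zero]
  have h6 : bB J (R *ᵥ x - pc p a *ᵥ x) v = 0 := by
    clear_value v
    rw [LinearMap.map_sub, LinearMap.sub_apply, h3, h4, sub_zero]
  rw [hu, map_add, map_add, map_smul, key2, h5, h6]
  simp

lemma pc_conj (A A' : Matrix (Fin n) (Fin n) ℝ) (c : Fin m → ℝ) :
    pc (fun j => A' * p j * A) c = A' * pc p c * A := by
  simp [pc, Finset.mul_sum, Finset.sum_mul]

lemma O_rel {A A' : Matrix (Fin n) (Fin n) ℝ} (hA : Aᵀ * J * A = J) (h1 : A * A' = 1) :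
    Aᵀ * J = J * A' ∧ A'ᵀ * J = J * A ∧ A'ᵀ * J * A' = J := by
  have e1 : Aᵀ * J = J * A' := by
    calc Aᵀ * J = Aᵀ * J * (A * A') := by rw [h1, mul_one]
      _ = Aᵀ * J * A * A' := by simp only [Matrix.mul_assoc]
      _ = J * A' := by rw [hA]
  have e0 : A'ᵀ * Aᵀ = 1 := by rw [← Matrix.transpose_mul, h1, Matrix.transpose_one]
  have e2 : A'ᵀ * J = J * A := by
    calc A'ᵀ * J = A'ᵀ * (Aᵀ * J * A) := by rw [hA]
      _ = A'ᵀ * Aᵀ * J * A := by simp only [Matrix.mul_assoc]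
      _ = J * A := by rw [e0, one_mul]
  refine ⟨e1, e2, ?_⟩
  rw [e2, Matrix.mul_assoc, h1, mul_one]

lemma cs_conj_mul {A A' : Matrix (Fin n) (Fin n) ℝ} (h1 : A * A' = 1)
    (X Y : Matrix (Fin n) (Fin n) ℝ) : (A' * X * A) * (A' * Y * A) = A' * (X * Y) * A := by
  calc (A' * X * A) * (A' * Y * A) = A' * X * (A * A') * Y * A := by
        simp only [Matrix.mul_assoc]
    _ = _ := by rw [h1, mul_one]; simp only [Matrix.mul_assoc]

lemma conj_sym {A A' : Matrix (Fin n) (Fin n) ℝ} (hA : Aᵀ * J * A = J) (h1 : A * A' = 1)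
    {X : Matrix (Fin n) (Fin n) ℝ} (hX : Xᵀ * J = J * X) :
    (A' * X * A)ᵀ * J = J * (A' * X * A) := by
  obtain ⟨e1, e2, -⟩ := O_rel hA h1
  rw [Matrix.transpose_mul, Matrix.transpose_mul]
  calc Aᵀ * (Xᵀ * A'ᵀ) * J = Aᵀ * (Xᵀ * (A'ᵀ * J)) := by simp only [Matrix.mul_assoc]
    _ = Aᵀ * (Xᵀ * J) * A := by rw [e2]; simp only [Matrix.mul_assoc]
    _ = (Aᵀ * J) * (X * A) := by rw [hX]; simp only [Matrix.mul_assoc]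
    _ = _ := by rw [e1]; simp only [Matrix.mul_assoc]

lemma CS.conj (h : CS J p η) {A A' : Matrix (Fin n) (Fin n) ℝ} (hA : Aᵀ * J * A = J)
    (h1 : A * A' = 1) (h2 : A' * A = 1) : CS J (fun j => A' * p j * A) η where
  JJ := h.JJ
  JT := h.JT
  ee := h.ee
  sym i := conj_sym hA h1 (h.sym i)
  sq i := by rw [cs_conj_mul h1, h.sq]; simp [h2]
  ac i j hij := by rw [cs_conj_mul h1, cs_conj_mul h1, h.ac i j hij]; simp

lemma bB_O {A A' : Matrix (Fin n) (Fin n) ℝ} (hA : Aᵀ * J * A = J) (h1 : A * A' = 1)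
    (X : Matrix (Fin n) (Fin n) ℝ) (x : Fin n → ℝ) :
    bB J ((A' * X * A) *ᵥ x) x = bB J (X *ᵥ (A *ᵥ x)) (A *ᵥ x) := by
  obtain ⟨e1, e2, e3⟩ := O_rel hA h1
  rw [bB_apply, bB_apply, Matrix.mulVec_mulVec, Matrix.mulVec_mulVec, ← e2, Matrix.mul_assoc,
    ← Matrix.mulVec_mulVec x A', ← Matrix.mulVec_mulVec x A'ᵀ,
    Matrix.dotProduct_mulVec _ A'ᵀ, Matrix.vecMul_transpose]

lemma CS.conj_normal (h : CS J p η) {A A' : Matrix (Fin n) (Fin n) ℝ} (hA : Aᵀ * J * A = J)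
    (h1 : A * A' = 1) {x0 x : Fin n → ℝ}
    (hAL : ∀ y ∈ connectedComponentIn (Mset J p) x0, A *ᵥ y ∈ connectedComponentIn (Mset J p) x0)
    (hx : x ∈ connectedComponentIn (Mset J p) x0) (c : Fin m → ℝ) :
    ∃ a, pc (fun j => A' * p j * A) c *ᵥ x = pc p a *ᵥ x := by
  refine ⟨_, h.normal (R := pc (fun j => A' * p j * A) c) ?_ ?_ hx⟩
  · rw [pc_conj]; exact conj_sym hA h1 (h.psym c)
  · intro y hy
    rw [pc_conj, bB_O hA h1, pc_mulVec]
    have := (mem_L (hAL y hy)).2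
    simp [-Matrix.mulVec_mulVec, this]

lemma analytic_qH : AnalyticOnNhd ℝ (qH J p η) Set.univ := by
  intro x _
  have hc : ∀ i : Fin n, AnalyticAt ℝ (fun y : Fin n → ℝ => y i) x := fun i =>
    (ContinuousLinearMap.proj (R := ℝ) (φ := fun _ : Fin n => ℝ) i).analyticAt x
  have hb : ∀ X : Matrix (Fin n) (Fin n) ℝ,
      AnalyticAt ℝ (fun y : Fin n → ℝ => bB J (X *ᵥ y) y) x := by
    intro X
    have e : (fun y : Fin n → ℝ => bB J (X *ᵥ y) y) =
        fun y => ∑ i, (∑ k, X i k * y k) * (∑ k, J i k * y k) := by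
      funext y
      rw [bB_apply]; rfl
    rw [e]
    refine Finset.analyticAt_fun_sum _ fun i _ => AnalyticAt.mul ?_ ?_
    · exact Finset.analyticAt_fun_sum _ fun k _ => analyticAt_const.mul (hc k)
    · exact Finset.analyticAt_fun_sum _ fun k _ => analyticAt_const.mul (hc k)
  unfold qH
  exact Finset.analyticAt_fun_sum _ fun j _ => analyticAt_const.mul ((hb (p j)).pow 2)

lemma CS.qH_inv (h : CS J p η) {A A' : Matrix (Fin n) (Fin n) ℝ} (hA : Aᵀ * J * A = J)
    (h1 : A * A' = 1) (h2 : A' * A = 1) {x0 : Fin n → ℝ} (hx0 : x0 ∈ Mset J p)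
    (hAL : ∀ y ∈ connectedComponentIn (Mset J p) x0, A *ᵥ y ∈ connectedComponentIn (Mset J p) x0)
    (hAL' : ∀ y ∈ connectedComponentIn (Mset J p) x0,
      A' *ᵥ y ∈ connectedComponentIn (Mset J p) x0) :
    qH J p η = qH J (fun j => A' * p j * A) η := by
  refine AnalyticOnNhd.eq_of_eventuallyEq analytic_qH analytic_qH (z₀ := x0) ?_
  filter_upwards [h.ret_near hx0] with y hy
  set x := ret J p η y
  have hxL := hy.2
  have hx := mem_L hxL
  have hyx := h.ret_eq hy.1
  obtain ⟨a, ha⟩ := h.conj_normal (O_rel hA h1).2.2 h2 hAL' (hAL x hxL) (rc J p η y)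
  have ha' : pc p (rc J p η y) *ᵥ x = pc (fun j => A' * p j * A) a *ᵥ x := by
    have h3 := congrArg (fun z => A' *ᵥ z) ha
    simp only [pc_conj, Matrix.mulVec_mulVec] at h3 ⊢
    have e : A' * (A * pc p (rc J p η y) * A' * A) = pc p (rc J p η y) := by
      calc _ = (A' * A) * pc p (rc J p η y) * (A' * A) := by simp only [Matrix.mul_assoc]
        _ = _ := by rw [h2, one_mul, mul_one]
    rw [e] at h3
    rw [h3, Matrix.mul_assoc]
  have hx' : ∀ j, bB J ((A' * p j * A) *ᵥ x) x = 0 := by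
    intro j
    rw [bB_O hA h1]; exact (mem_L (hAL x hxL)).2 j
  have v1 := h.Hval x hx.2 hx.1 (ra J p η y) (rc J p η y)
  have v2 := (h.conj hA h1 h2).Hval x hx' hx.1 (ra J p η y) a
  rw [← ha'] at v2
  change ra J p η y • x + pc p (rc J p η y) *ᵥ x = y at hyx
  rw [hyx] at v1 v2
  rw [v1, v2]

end Inv


section Theta

variable {n m : ℕ} {J : Matrix (Fin n) (Fin n) ℝ}
    {p : Fin m → Matrix (Fin n) (Fin n) ℝ} {η : Fin m → ℝ}

/-- polarised quartic form -/
def qT (J : Matrix (Fin n) (Fin n) ℝ) (p : Fin m → Matrix (Fin n) (Fin n) ℝ) (η : Fin m → ℝ)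
    (x y u v : Fin n → ℝ) : ℝ :=
  ∑ j, η j * (bB J (p j *ᵥ x) y * bB J (p j *ᵥ u) v + bB J (p j *ᵥ x) u * bB J (p j *ᵥ y) v
    + bB J (p j *ᵥ x) v * bB J (p j *ᵥ y) u)

lemma CS.qT_eq (h : CS J p η) (x y u v : Fin n → ℝ) :
    8 * qT J p η x y u v =
      qH J p η (x + y + u + v)
      - qH J p η (x + y + u) - qH J p η (x + y + v) - qH J p η (x + u + v) - qH J p η (y + u + v)
      + qH J p η (x + y) + qH J p η (x + u) + qH J p η (x + v) + qH J p η (y + u)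
      + qH J p η (y + v) + qH J p η (u + v)
      - qH J p η x - qH J p η y - qH J p η u - qH J p η v := by
  simp only [qT, qH, Finset.mul_sum, ← Finset.sum_sub_distrib, ← Finset.sum_add_distrib]
  refine Finset.sum_congr rfl fun j _ => ?_
  have hs : ∀ a b, bB J (p j *ᵥ a) b = bB J (p j *ᵥ b) a := fun a b => by
    rw [bB_adj (h.sym j), bB_symm h.JT]
  simp only [Matrix.mulVec_add, map_add, LinearMap.add_apply]
  rw [hs y x, hs u x, hs v x, hs u y, hs v y, hs v u]
  ring

lemma sum_contr (h1 : J * J = 1) (h2 : Jᵀ = J) {X : Matrix (Fin n) (Fin n) ℝ}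
    (hX : Xᵀ * J = J * X) (a b : Fin n → ℝ) :
    ∑ i, bB J a (Pi.single i 1) * bB J b (X *ᵥ (J *ᵥ Pi.single i 1)) = bB J a (X *ᵥ b) := by
  have e1 : ∀ i : Fin n, bB J a (Pi.single i 1) = (J *ᵥ a) i := by
    intro i
    rw [bB_symm h2, bB_apply]; simp
  have e2 : ∀ i, bB J b (X *ᵥ (J *ᵥ Pi.single i 1)) = (X *ᵥ b) i := by
    intro i
    rw [← bB_adj hX, bB_apply, Matrix.mulVec_mulVec, h1, Matrix.one_mulVec]; simp
  simp only [e1, e2]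
  rw [bB_symm h2, bB_apply, dotProduct]
  exact Finset.sum_congr rfl fun i _ => mul_comm _ _

lemma sum_trace (h1 : J * J = 1) {X Y : Matrix (Fin n) (Fin n) ℝ}
    (hY : Yᵀ * J = J * Y) :
    ∑ i, bB J (Y *ᵥ Pi.single i 1) (X *ᵥ (J *ᵥ Pi.single i 1)) = (Y * X).trace := by
  have e : (Y * X).trace = (J * (Y * X * J)).trace := by
    rw [Matrix.trace_mul_comm J, Matrix.mul_assoc _ J J, h1, mul_one]
  rw [e, Matrix.trace]
  refine Finset.sum_congr rfl fun i _ => ?_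
  rw [bB_adj hY, bB_apply]
  simp only [Matrix.mulVec_mulVec, single_one_dotProduct]
  simp [Matrix.mul_assoc]

/-- contracted quartic form -/
def Th (p : Fin m → Matrix (Fin n) (Fin n) ℝ) (η : Fin m → ℝ) (X : Matrix (Fin n) (Fin n) ℝ) :
    Matrix (Fin n) (Fin n) ℝ :=
  ∑ j, η j • ((p j * X).trace • p j + (2:ℝ) • (p j * X * p j))

lemma CS.contr (h : CS J p η) {X : Matrix (Fin n) (Fin n) ℝ} (hX : Xᵀ * J = J * X)
    (x y : Fin n → ℝ) :
    ∑ i, qT J p η x y (Pi.single i 1) (X *ᵥ (J *ᵥ Pi.single i 1)) = bB J x (Th p η X *ᵥ y) := by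
  have e : bB J x (Th p η X *ᵥ y) = ∑ j, η j * ((p j * X).trace * bB J x (p j *ᵥ y)
      + 2 * bB J x ((p j * X * p j) *ᵥ y)) := by
    simp [Th, Matrix.sum_mulVec, Matrix.smul_mulVec, Matrix.add_mulVec, mul_add]
  rw [e]
  simp only [qT]
  rw [Finset.sum_comm]
  refine Finset.sum_congr rfl fun j _ => ?_
  rw [← Finset.mul_sum, Finset.sum_add_distrib, Finset.sum_add_distrib, ← Finset.mul_sum,
    sum_trace h.JJ (h.sym j), sum_contr h.JJ h.JT hX]
  have e3 := sum_contr h.JJ h.JT hX (p j *ᵥ y) (p j *ᵥ x)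
  simp only [mul_comm (bB J (p j *ᵥ y) _)] at e3
  rw [e3, bB_symm h.JT (p j *ᵥ y), bB_adj hX, bB_adj (h.sym j), bB_adj (h.sym j)]
  simp only [Matrix.mulVec_mulVec, Matrix.mul_assoc]
  ring

lemma CS.Th_inv (h : CS J p η) {p' : Fin m → Matrix (Fin n) (Fin n) ℝ} (h' : CS J p' η)
    (hq : qH J p η = qH J p' η) {X : Matrix (Fin n) (Fin n) ℝ} (hX : Xᵀ * J = J * X) :
    Th p η X = Th p' η X := by
  have hT : ∀ x y u v, qT J p η x y u v = qT J p' η x y u v := by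
    intro x y u v
    have a := h.qT_eq x y u v
    have b := h'.qT_eq x y u v
    rw [hq] at a
    linarith
  have e : ∀ x y, bB J x (Th p η X *ᵥ y) = bB J x (Th p' η X *ᵥ y) := by
    intro x y
    rw [← h.contr hX, ← h'.contr hX]; simp only [hT]
  refine Matrix.toLin'.injective (LinearMap.ext fun y => ?_)
  rw [← sub_eq_zero]
  refine bB_nondeg h.JJ _ fun x => ?_
  rw [bB_symm h.JT, map_sub, Matrix.toLin'_apply, Matrix.toLin'_apply, e, sub_self]

lemma CS.tr_ij (h : CS J p η) {i j : Fin m} (hij : i ≠ j) : (p i * p j).trace = 0 := by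
  have := congrArg Matrix.trace (h.ac i j hij)
  rw [Matrix.trace_neg, Matrix.trace_mul_comm (p j)] at this
  linarith

lemma CS.tr_ii (h : CS J p η) (i : Fin m) : (p i * p i).trace = η i * n := by
  rw [h.sq, Matrix.trace_smul, Matrix.trace_one]; simp

/-- `Σ η_j p_j X p_j` -/
def Ps (p : Fin m → Matrix (Fin n) (Fin n) ℝ) (η : Fin m → ℝ) (X : Matrix (Fin n) (Fin n) ℝ) :
    Matrix (Fin n) (Fin n) ℝ := ∑ j, η j • (p j * X * p j)

lemma CS.Ps_self (h : CS J p η) (k : Fin m) : Ps p η (p k) = (2 - m : ℝ) • p k := by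
  have e : ∀ j, η j • (p j * p k * p j) = (if j = k then (2:ℝ) • p k else 0) - p k := by
    intro j
    split_ifs with hjk
    · subst hjk
      rw [h.sq, smul_mul_assoc, one_mul, smul_smul, h.ee, one_smul, two_smul]; abel
    · rw [h.ac j k hjk, neg_mul, Matrix.mul_assoc, h.sq, mul_smul_comm, mul_one, smul_neg,
        smul_smul, h.ee, one_smul, zero_sub]
  simp only [Ps, e, Finset.sum_sub_distrib, Finset.sum_ite_eq', Finset.mem_univ, if_true]
  rw [sub_smul, Finset.sum_const, Finset.card_univ, Fintype.card_fin, Nat.cast_smul_eq_nsmul]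

lemma Th_eq (X : Matrix (Fin n) (Fin n) ℝ) :
    Th p η X = pc p (fun j => η j * (p j * X).trace) + (2:ℝ) • Ps p η X := by
  simp only [Th, pc, Ps, Finset.smul_sum, ← Finset.sum_add_distrib, smul_add, smul_smul]
  refine Finset.sum_congr rfl fun j _ => ?_
  rw [mul_comm (η j) 2]

lemma CS.Th_self (h : CS J p η) (k : Fin m) : Th p η (p k) = (n + 4 - 2 * m : ℝ) • p k := by
  rw [Th_eq, h.Ps_self, smul_smul, pc, Finset.sum_eq_single k]
  · rw [h.tr_ii, ← add_smul]; congr 1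
    have := h.ee k
    linear_combination (n:ℝ) * this
  · intro j _ hj; simp [h.tr_ij hj]
  · simp

lemma Ps_pc (c : Fin m → ℝ) : Ps p η (pc p c) = ∑ k, c k • Ps p η (p k) := by
  simp only [Ps, pc, Finset.mul_sum, Finset.sum_mul, Finset.smul_sum]
  rw [Finset.sum_comm]
  refine Finset.sum_congr rfl fun j _ => Finset.sum_congr rfl fun k _ => ?_
  simp [smul_comm (η _) (c _)]

lemma Ps_sub (X Y : Matrix (Fin n) (Fin n) ℝ) : Ps p η (X - Y) = Ps p η X - Ps p η Y := by
  simp [Ps, mul_sub, sub_mul, smul_sub]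

/-- a symmetric eigenvector of `Th` splits -/
lemma CS.Th_split (h : CS J p η) (hn : 0 < n) {X : Matrix (Fin n) (Fin n) ℝ}
    (hX : Th p η X = (n + 4 - 2 * m : ℝ) • X) :
    ∃ c C, X = pc p c + C ∧ Ps p η C = (n / 2 + 2 - m : ℝ) • C := by
  have hn' : (n:ℝ) ≠ 0 := by positivity
  refine ⟨fun j => η j * (p j * X).trace / n,
    X - pc p (fun j => η j * (p j * X).trace / n), by abel, ?_⟩
  have e1 : pc p (fun j => η j * (p j * X).trace) =
      (n:ℝ) • pc p (fun j => η j * (p j * X).trace / n) := by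
    simp only [pc, Finset.smul_sum, smul_smul]
    refine Finset.sum_congr rfl fun j _ => ?_
    congr 1; field_simp
  rw [Th_eq, e1] at hX
  set c := fun j => η j * (p j * X).trace / n
  have e2 : Ps p η (pc p c) = (2 - m : ℝ) • pc p c := by
    rw [Ps_pc]
    simp only [h.Ps_self, pc, Finset.smul_sum]
    exact Finset.sum_congr rfl fun j _ => smul_comm _ _ _
  have e3 : Ps p η X = (1/2 : ℝ) • ((n + 4 - 2 * m : ℝ) • X - (n:ℝ) • pc p c) := by
    rw [← hX]; module
  rw [Ps_sub, e2, e3]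
  module

end Theta


lemma spectral {ι W : Type*} [AddCommGroup W] [Module ℝ W] (f : ι → W →ₗ[ℝ] W)
    (hinv : ∀ i x, f i (f i x) = x) (hcomm : ∀ i j x, f i (f j x) = f j (f i x))
    (s : Finset ι) : ∀ (c : ℝ) (x : W), (s.card : ℝ) ≤ c → ∑ i ∈ s, f i x = c • x →
      ∀ i ∈ s, f i x = x := by
  classical
  induction s using Finset.induction_on with
  | empty => simp
  | insert k s hk ih =>
    intro c x hc hx
    rw [Finset.sum_insert hk] at hx
    rw [Finset.card_insert_of_notMem hk] at hc
    push_cast at hc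
    have hs : ∑ i ∈ s, f i x = c • x - f k x := by rw [← hx]; abel
    have hs' : ∑ i ∈ s, f i (f k x) = c • f k x - x := by
      have : ∑ i ∈ s, f i (f k x) = f k (∑ i ∈ s, f i x) := by
        rw [map_sum]; exact Finset.sum_congr rfl fun i _ => hcomm _ _ _
      rw [this, hs, map_sub, map_smul, hinv]
    have h1 := ih (c - 1) (x + f k x) (by linarith) (by
      simp only [map_add, Finset.sum_add_distrib, hs, hs']; module)
    have h2s : ∑ i ∈ s, f i (x - f k x) = (c + 1) • (x - f k x) := by
      simp only [map_sub, Finset.sum_sub_distrib, hs, hs']; module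
    have h2 := ih (c + 1) (x - f k x) (by linarith) h2s
    have h3 : (s.card : ℝ) • (x - f k x) = (c + 1) • (x - f k x) := by
      rw [← h2s, Finset.sum_congr rfl h2, Finset.sum_const, Nat.cast_smul_eq_nsmul]
    have h4 : (c + 1 - s.card : ℝ) • (x - f k x) = 0 := by
      rw [sub_smul, h3, sub_self]
    have h5 : x - f k x = 0 := (smul_eq_zero.1 h4).resolve_left (by
      have : (0:ℝ) < c + 1 - s.card := by linarith
      exact this.ne')
    have h6 : f k x = x := (sub_eq_zero.1 h5).symm
    intro i hi
    rcases Finset.mem_insert.1 hi with rfl | hi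
    · exact h6
    · have := h1 i hi
      rw [h6, map_add, ← two_smul ℝ, ← two_smul ℝ] at this
      exact smul_right_injective _ (two_ne_zero (α := ℝ)) this

lemma div_complex (k : ℕ) : ∀ (V : Type) [AddCommGroup V] [Module ℂ V] [FiniteDimensional ℂ V]
    (P : ℕ → V →ₗ[ℂ] V) (a : ℕ → ℂ) (_ : ∀ i < 2 * k, a i ≠ 0)
    (_ : ∀ i < 2 * k, ∀ x, P i (P i x) = a i • x)
    (_ : ∀ i < 2 * k, ∀ j < 2 * k, i ≠ j → ∀ x, P i (P j x) = - P j (P i x)),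
    2 ^ k ∣ Module.finrank ℂ V := by
  induction k with
  | zero => intros; simp
  | succ k ih =>
    intro V _ _ _ P a ha hsq hac
    obtain ⟨μ, hμ⟩ := IsAlgClosed.exists_pow_nat_eq (-(a 0 * a 1)) (n := 2) (by norm_num)
    have h01 := hac 0 (by omega) 1 (by omega) (by omega)
    have h0 := hsq 0 (by omega)
    have h1 := hsq 1 (by omega)
    have hμ0 : μ ≠ 0 := by
      rintro rfl
      have := mul_ne_zero (ha 0 (by omega)) (ha 1 (by omega))
      apply this
      linear_combination hμ
    let ω : V →ₗ[ℂ] V := P 0 ∘ₗ P 1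
    have hω : ∀ x, ω x = P 0 (P 1 x) := fun x => rfl
    have hωω : ∀ x, ω (ω x) = (μ ^ 2) • x := by
      intro x
      rw [hω, hω, h01 x, map_neg, h1, map_neg, map_smul, h0, smul_smul, hμ, neg_smul,
        mul_comm]
    have hω0 : ∀ x, ω (P 0 x) = - P 0 (ω x) := by
      intro x
      rw [hω, hω, h01 x, map_neg, neg_neg]
    have hωi : ∀ i < 2 * k, ∀ x, ω (P (i + 2) x) = P (i + 2) (ω x) := by
      intro i hi x
      rw [hω, hω, hac 1 (by omega) (i + 2) (by omega) (by omega), map_neg,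
        hac 0 (by omega) (i + 2) (by omega) (by omega), neg_neg]
    let E : ℂ → Submodule ℂ V := fun z => LinearMap.ker (ω - z • LinearMap.id)
    have hE : ∀ z x, x ∈ E z ↔ ω x = z • x := by
      intro z x; simp [E, sub_eq_zero]
    have hcompl : IsCompl (E μ) (E (-μ)) := by
      refine IsCompl.of_eq ?_ ?_
      · rw [eq_bot_iff]
        rintro x ⟨hx1, hx2⟩
        have e1 := (hE _ _).1 hx1
        have e2 := (hE _ _).1 hx2
        rw [e1] at e2
        have : (2 * μ) • x = 0 := by
          rw [neg_smul] at e2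
          rw [two_mul, add_smul]; nth_rewrite 1 [e2]; simp
        exact (smul_eq_zero.1 this).resolve_left (by simp [hμ0])
      · rw [eq_top_iff]
        intro x _
        rw [Submodule.mem_sup]
        refine ⟨(2 * μ)⁻¹ • (μ • x + ω x), ?_, (2 * μ)⁻¹ • (μ • x - ω x), ?_, ?_⟩
        · rw [hE, map_smul, map_add, map_smul, hωω]; module
        · rw [hE, map_smul, map_sub, map_smul, hωω]; module
        · rw [← smul_add, add_add_sub_cancel, ← two_smul ℂ, smul_smul, smul_smul, mul_assoc]
          rw [show (2 * μ)⁻¹ * (2 * μ) = 1 from inv_mul_cancel₀ (by simp [hμ0]), one_smul]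
    have hP0inj : Function.Injective (P 0) := by
      intro x y hxy
      have := congrArg (P 0) hxy
      rw [h0, h0] at this
      exact smul_right_injective _ (ha 0 (by omega)) this
    have hle : ∀ z, Module.finrank ℂ (E z) ≤ Module.finrank ℂ (E (-z)) := by
      intro z
      refine LinearMap.finrank_le_finrank_of_injective
        (f := (P 0).restrict (p := E z) (q := E (-z)) ?_) ?_
      · intro x hx
        rw [hE] at hx ⊢
        rw [hω0, hx, map_smul, neg_smul]
      · intro x y hxy
        exact Subtype.ext (hP0inj (congrArg Subtype.val hxy))
    have hfe : Module.finrank ℂ (E μ) = Module.finrank ℂ (E (-μ)) := by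
      refine le_antisymm (hle μ) ?_
      have := hle (-μ)
      rwa [neg_neg] at this
    have hsum := Submodule.finrank_add_eq_of_isCompl hcompl
    rw [← hfe] at hsum
    have hpres : ∀ i < 2 * k, ∀ x ∈ E μ, P (i + 2) x ∈ E μ := by
      intro i hi x hx
      rw [hE] at hx ⊢
      rw [hωi i hi, hx, map_smul]
    classical
    have hdiv := ih (E μ)
      (fun i => if hi : i < 2 * k then (P (i + 2)).restrict (hpres i hi) else 0)
      (fun i => a (i + 2)) (fun i hi => ha _ (by omega))
      (by
        intro i hi x
        simp only [hi, dif_pos]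
        exact Subtype.ext (hsq (i + 2) (by omega) x))
      (by
        intro i hi j hj hij x
        simp only [hi, hj, dif_pos]
        exact Subtype.ext (hac (i + 2) (by omega) (j + 2) (by omega) (by omega) x))
    rw [← hsum, pow_succ, ← two_mul, mul_comm]
    exact Nat.mul_dvd_mul_left 2 hdiv

lemma div_real {n k : ℕ} (P : ℕ → Matrix (Fin n) (Fin n) ℝ) (a : ℕ → ℝ)
    (ha : ∀ i < 2 * k, a i ≠ 0) (hsq : ∀ i < 2 * k, P i * P i = a i • 1)
    (hac : ∀ i < 2 * k, ∀ j < 2 * k, i ≠ j → P i * P j = - (P j * P i)) : 2 ^ k ∣ n := by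
  have h := div_complex k (Fin n → ℂ)
    (fun i => Matrix.mulVecLin ((P i).map Complex.ofRealHom)) (fun i => (a i : ℂ))
    (fun i hi => by simpa using ha i hi) ?_ ?_
  · simpa using h
  · intro i hi x
    simp only [Matrix.mulVecLin_apply, Matrix.mulVec_mulVec]
    rw [← Matrix.map_mul, hsq i hi]
    have : ((a i • (1 : Matrix (Fin n) (Fin n) ℝ)).map Complex.ofRealHom) = (a i : ℂ) • 1 := by
      ext u v
      by_cases huv : u = v
      · subst huv; simp
      · simp [huv]
    rw [this, Matrix.smul_mulVec, Matrix.one_mulVec]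
  · intro i hi j hj hij x
    simp only [Matrix.mulVecLin_apply, Matrix.mulVec_mulVec]
    rw [← Matrix.map_mul, ← Matrix.map_mul, hac i hi j hj hij,
      ← Matrix.neg_mulVec]
    congr 1
    ext u v
    simp [-Matrix.map_mul]

lemma num_one (t : ℕ) : 16 * (t + 3) ≤ 2 ^ (2 * (t + 3)) + 4 := by
  induction t with
  | zero => norm_num
  | succ t ih =>
    have : 2 ^ (2 * (t + 1 + 3)) = 4 * 2 ^ (2 * (t + 3)) := by
      rw [show 2 * (t + 1 + 3) = 2 * (t + 3) + 2 by ring, pow_add]; ring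
    omega

lemma num_two {l t : ℕ} (ht : 0 < t) (h : 2 ^ (2 * t) ∣ 2 * l) (hl : 4 * t < l) :
    8 * t ≤ l + 2 := by
  rcases t with _ | _ | _ | t
  · omega
  · norm_num at h; omega
  · norm_num at h; omega
  · have := num_one t
    have := Nat.le_of_dvd (by omega) h
    rw [show t + 1 + 1 + 1 = t + 3 by ring] at *
    omega

lemma num_three {m : ℕ} (hm : 4 ≤ m) : 4 * m ≤ 2 ^ m := by
  induction m, hm using Nat.le_induction with
  | base => norm_num
  | succ k hk ih => rw [pow_succ]; omega


section Words

variable {n m : ℕ} {J : Matrix (Fin n) (Fin n) ℝ}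
    {p : Fin m → Matrix (Fin n) (Fin n) ℝ} {η : Fin m → ℝ}

/-- products of the Clifford system along words -/
def wd (p : Fin m → Matrix (Fin n) (Fin n) ℝ) (w : List (Fin m)) : Matrix (Fin n) (Fin n) ℝ :=
  (w.map p).prod

lemma wd_nil : wd p [] = 1 := rfl

lemma wd_cons (i : Fin m) (w : List (Fin m)) : wd p (i :: w) = p i * wd p w := by
  simp [wd]

lemma wd_append (w u : List (Fin m)) : wd p (w ++ u) = wd p w * wd p u := by
  simp [wd]

/-- the volume element -/
def vol (p : Fin m → Matrix (Fin n) (Fin n) ℝ) : Matrix (Fin n) (Fin n) ℝ :=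
  wd p (List.finRange m)

lemma CS.wd_comm (h : CS J p η) (j : Fin m) (w : List (Fin m)) :
    p j * wd p w = (-1 : ℝ) ^ (w.length + w.count j) • (wd p w * p j) := by
  induction w with
  | nil => simp [wd_nil]
  | cons i w ih =>
    rw [wd_cons, List.length_cons, List.count_cons]
    by_cases hij : i = j
    · subst hij
      simp only [beq_self_eq_true, if_true]
      rw [show w.length + 1 + (w.count i + 1) = w.length + w.count i + 2 by ring, pow_add,
        Matrix.mul_assoc (p i) (wd p w), show ((-1:ℝ) ^ 2) = 1 by norm_num, mul_one,
        ← mul_smul_comm, ← ih]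
    · have : (i == j) = false := by simpa using hij
      rw [this]
      simp only [Bool.false_eq_true, if_false, add_zero]
      rw [← Matrix.mul_assoc, h.ac j i (Ne.symm hij), neg_mul, Matrix.mul_assoc, ih,
        show w.length + 1 + w.count j = w.length + w.count j + 1 by ring, pow_succ,
        mul_smul_comm, Matrix.mul_assoc]
      simp

lemma CS.vol_anti (h : CS J p η) (hm : Even m) (j : Fin m) : p j * vol p = -(vol p * p j) := by
  rw [vol, h.wd_comm, List.length_finRange,
    List.count_eq_one_of_mem (List.nodup_finRange m) (List.mem_finRange j), pow_succ,
    hm.neg_one_pow]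
  simp

lemma CS.wd_miss (h : CS J p η) (hm : Even m) (j : Fin m) (w : List (Fin m)) (hw : w.length = m)
    (hj : j ∉ w) : p j * wd p w = wd p w * p j := by
  rw [h.wd_comm, hw, List.count_eq_zero_of_not_mem hj, add_zero, hm.neg_one_pow, one_smul]

lemma CS.wd_perm (h : CS J p η) {w u : List (Fin m)} (hwu : w.Perm u) :
    ∃ e : ℝ, wd p w = e • wd p u := by
  induction hwu with
  | nil => exact ⟨1, by simp⟩
  | cons x _ ih =>
    obtain ⟨e, he⟩ := ih
    exact ⟨e, by rw [wd_cons, wd_cons, he, mul_smul_comm]⟩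
  | swap x y l =>
    by_cases hxy : y = x
    · subst hxy; exact ⟨1, by simp⟩
    · refine ⟨-1, ?_⟩
      simp only [wd_cons]
      rw [← Matrix.mul_assoc, h.ac y x hxy, neg_mul, Matrix.mul_assoc]; simp
  | trans _ _ ih1 ih2 =>
    obtain ⟨e, he⟩ := ih1
    obtain ⟨f, hf⟩ := ih2
    exact ⟨e * f, by rw [he, hf, smul_smul]⟩

lemma CS.wd_full (h : CS J p η) (w : List (Fin m)) (hw : w.length = m) (hj : ∀ j, j ∈ w) :
    ∃ e : ℝ, wd p w = e • vol p := by
  refine h.wd_perm ?_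
  have hnd : w.Nodup := by
    have h1 : w.toFinset = Finset.univ := by ext j; simp [hj]
    refine Multiset.coe_nodup.1 (Multiset.toFinset_card_eq_card_iff_nodup.1 ?_)
    change w.toFinset.card = w.length
    rw [h1, Finset.card_univ, Fintype.card_fin, hw]
  exact (List.perm_ext_iff_of_nodup hnd (List.nodup_finRange m)).2 fun a => by simp [hj]

lemma CS.wd_rev (h : CS J p η) (w : List (Fin m)) (hw : w.Nodup) :
    wd p w.reverse = (-1 : ℝ) ^ (∑ i ∈ Finset.range w.length, i) • wd p w := by
  induction w with
  | nil => simp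
  | cons i w ih =>
    rw [List.nodup_cons] at hw
    rw [List.reverse_cons, wd_append, ih hw.2, wd_cons, wd_cons, wd_nil, mul_one, h.wd_comm,
      List.count_eq_zero_of_not_mem hw.1, add_zero, smul_mul_assoc, List.length_cons,
      Finset.sum_range_succ, pow_add, smul_smul, mul_assoc, ← pow_add, ← two_mul,
      Even.neg_one_pow (even_two_mul _), mul_one]

lemma CS.wd_sym (h : CS J p η) (w : List (Fin m)) : (wd p w)ᵀ * J = J * wd p w.reverse := by
  induction w with
  | nil => simp [wd_nil]
  | cons i w ih =>
    rw [List.reverse_cons, wd_append, wd_cons, wd_cons, wd_nil, mul_one, Matrix.transpose_mul,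
      Matrix.mul_assoc, h.sym, ← Matrix.mul_assoc, ih, Matrix.mul_assoc]

lemma CS.wd_wd (h : CS J p η) (w : List (Fin m)) :
    wd p w * wd p w.reverse = (w.map η).prod • 1 := by
  induction w with
  | nil => simp [wd_nil]
  | cons i w ih =>
    rw [List.reverse_cons, wd_append, wd_cons, wd_cons, wd_nil, mul_one, Matrix.mul_assoc,
      ← Matrix.mul_assoc (wd p w), ih, smul_mul_assoc, one_mul, mul_smul_comm, h.sq, smul_smul,
      List.map_cons, List.prod_cons, mul_comm]

lemma CS.vol_rev (h : CS J p η) (hm : m % 4 = 0) : wd p (List.finRange m).reverse = vol p := by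
  rw [h.wd_rev _ (List.nodup_finRange m), List.length_finRange, Finset.sum_range_id, vol]
  obtain ⟨k, hk⟩ : ∃ k, m = 4 * k := ⟨m / 4, by omega⟩
  have : m * (m - 1) / 2 = 2 * (k * (m - 1)) := by
    rw [show m * (m - 1) = 2 * (k * (m - 1)) * 2 by rw [hk]; ring]
    exact Nat.mul_div_cancel _ (by norm_num)
  rw [this, Even.neg_one_pow (even_two_mul _), one_smul]

lemma CS.vol_sym (h : CS J p η) (hm : m % 4 = 0) : (vol p)ᵀ * J = J * vol p := by
  have := h.wd_sym (List.finRange m)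
  rwa [h.vol_rev hm] at this

lemma CS.vol_sq (h : CS J p η) (hm : m % 4 = 0) (hη : ∏ j, η j = 1) : vol p * vol p = 1 := by
  have := h.wd_wd (List.finRange m)
  rw [h.vol_rev hm] at this
  rw [show vol p * vol p = wd p (List.finRange m) * vol p from rfl, this]
  have e : (List.map η (List.finRange m)).prod = 1 := by
    rw [← hη, ← List.prod_ofFn, List.ofFn_eq_map]
  rw [e, one_smul]

/-- words of length `k` containing all letters of `t` -/
def wset (p : Fin m → Matrix (Fin n) (Fin n) ℝ) (k : ℕ) (t : Finset (Fin m)) :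
    Set (Matrix (Fin n) (Fin n) ℝ) := {X | ∃ w : List (Fin m), w.length = k ∧ (∀ j ∈ t, j ∈ w) ∧
      X = wd p w}

lemma CS.anti_unique (h : CS J p η) (hm : Even m) {X : Matrix (Fin n) (Fin n) ℝ}
    (hX : X ∈ Submodule.span ℝ (wset p m ∅)) (ha : ∀ j, p j * X = -(X * p j)) :
    ∃ e : ℝ, X = e • vol p := by
  classical
  have key : ∀ t : Finset (Fin m), X ∈ Submodule.span ℝ (wset p m t) := by
    intro t
    induction t using Finset.induction_on with
    | empty => exact hX
    | insert k t _ ih =>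
      let φ : Matrix (Fin n) (Fin n) ℝ →ₗ[ℝ] Matrix (Fin n) (Fin n) ℝ :=
        LinearMap.id - η k • (LinearMap.mulLeft ℝ (p k) ∘ₗ LinearMap.mulRight ℝ (p k))
      have hφ : ∀ Y, φ Y = Y - η k • (p k * (Y * p k)) := fun Y => rfl
      have hφX : φ X = (2:ℝ) • X := by
        rw [hφ, ← neg_neg (X * p k), ← ha, mul_neg, ← Matrix.mul_assoc, h.sq, smul_mul_assoc,
          one_mul, smul_neg, smul_smul, h.ee, one_smul, two_smul]; abel
      have hle : Submodule.span ℝ (wset p m t) ≤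
          (Submodule.span ℝ (wset p m (insert k t))).comap φ := by
        rw [Submodule.span_le]
        rintro _ ⟨w, hw, hwt, rfl⟩
        change φ (wd p w) ∈ Submodule.span ℝ (wset p m (insert k t))
        by_cases hkw : k ∈ w
        · have hw' : wd p w ∈ Submodule.span ℝ (wset p m (insert k t)) := by
            refine Submodule.subset_span ⟨w, hw, ?_, rfl⟩
            intro j hj
            rcases Finset.mem_insert.1 hj with rfl | hj
            · exact hkw
            · exact hwt j hj
          rw [hφ, ← Matrix.mul_assoc, h.wd_comm, smul_mul_assoc, Matrix.mul_assoc, h.sq]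
          refine Submodule.sub_mem _ hw' ?_
          rw [mul_smul_comm, mul_one]
          exact Submodule.smul_mem _ _ (Submodule.smul_mem _ _ (Submodule.smul_mem _ _ hw'))
        · rw [hφ, ← h.wd_miss hm k w hw hkw, ← Matrix.mul_assoc, h.sq, smul_mul_assoc, one_mul,
            smul_smul, h.ee, one_smul, sub_self]
          exact Submodule.zero_mem _
      have h2 : φ X ∈ Submodule.span ℝ (wset p m (insert k t)) := hle ih
      rw [hφX] at h2
      have := Submodule.smul_mem _ (1/2:ℝ) h2
      rwa [smul_smul, show (1/2:ℝ) * 2 = 1 by norm_num, one_smul] at this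
  have h1 : Submodule.span ℝ (wset p m Finset.univ) ≤ Submodule.span ℝ {vol p} := by
    rw [Submodule.span_le]
    rintro _ ⟨w, hw, hwt, rfl⟩
    obtain ⟨e, he⟩ := h.wd_full w hw (fun j => hwt j (Finset.mem_univ j))
    rw [he]
    exact Submodule.smul_mem _ _ (Submodule.mem_span_singleton_self _)
  obtain ⟨e, he⟩ := Submodule.mem_span_singleton.1 (h1 (key Finset.univ))
  exact ⟨e, he.symm⟩

lemma wd_span {p' : Fin m → Matrix (Fin n) (Fin n) ℝ} {a : Fin m → Fin m → ℝ}
    (ha : ∀ k, p' k = pc p (a k)) (w : List (Fin m)) :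
    wd p' w ∈ Submodule.span ℝ (wset p w.length ∅) := by
  induction w with
  | nil => exact Submodule.subset_span ⟨[], by simp [wd_nil]⟩
  | cons k w ih =>
    rw [wd_cons, ha, pc, Finset.sum_mul]
    refine Submodule.sum_mem _ fun j _ => ?_
    rw [smul_mul_assoc]
    refine Submodule.smul_mem _ _ ?_
    have hle : Submodule.span ℝ (wset p w.length ∅) ≤
        (Submodule.span ℝ (wset p (k :: w).length ∅)).comap (LinearMap.mulLeft ℝ (p j)) := by
      rw [Submodule.span_le]
      rintro _ ⟨u, hu, -, rfl⟩
      refine Submodule.subset_span ⟨j :: u, by simp [hu], by simp, ?_⟩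
      rw [wd_cons]; rfl
    exact hle ih

lemma wd_conj {A A' : Matrix (Fin n) (Fin n) ℝ} (h1 : A * A' = 1) (h2 : A' * A = 1)
    (w : List (Fin m)) : wd (fun j => A' * p j * A) w = A' * wd p w * A := by
  induction w with
  | nil => simp [wd_nil, h2]
  | cons k w ih => rw [wd_cons, wd_cons, ih, cs_conj_mul h1]

lemma CS.vol_conj (h : CS J p η) (hn : 0 < n) (hm : m % 4 = 0) (hη : ∏ j, η j = 1)
    {A A' : Matrix (Fin n) (Fin n) ℝ}
    (h1 : A * A' = 1) (h2 : A' * A = 1) {a b : Fin m → Fin m → ℝ}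
    (ha : ∀ k, A' * p k * A = pc p (a k)) (hb : ∀ k, A * p k * A' = pc p (b k)) :
    ∃ e : ℝ, e ^ 2 = 1 ∧ A' * vol p * A = e • vol p := by
  have hme : Even m := ⟨m / 2, by omega⟩
  have hanti : ∀ j, p j * (A' * vol p * A) = -((A' * vol p * A) * p j) := by
    intro j
    have e1 : p j = A' * pc p (b j) * A := by
      rw [← hb]
      calc p j = (A' * A) * p j * (A' * A) := by rw [h2, one_mul, mul_one]
        _ = _ := by simp only [Matrix.mul_assoc]
    have e2 : pc p (b j) * vol p = -(vol p * pc p (b j)) := by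
      simp [pc, Finset.sum_mul, Finset.mul_sum, h.vol_anti hme]
    rw [e1, cs_conj_mul h1, cs_conj_mul h1, e2]; simp
  have hspan : A' * vol p * A ∈ Submodule.span ℝ (wset p m ∅) := by
    have := wd_span (p := p) (p' := fun j => A' * p j * A) ha (List.finRange m)
    rwa [wd_conj h1 h2, List.length_finRange] at this
  obtain ⟨e, he⟩ := h.anti_unique hme hspan hanti
  refine ⟨e, ?_, he⟩
  have hsq : (A' * vol p * A) * (A' * vol p * A) = 1 := by
    rw [cs_conj_mul h1, h.vol_sq hm hη, mul_one, h2]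
  rw [he, smul_mul_assoc, mul_smul_comm, smul_smul, h.vol_sq hm hη] at hsq
  have := congrFun (congrFun hsq ⟨0, hn⟩) ⟨0, hn⟩
  simp at this
  rw [pow_two]; linarith

end Words


section SpanPart

variable {n m : ℕ} {J : Matrix (Fin n) (Fin n) ℝ}
    {p : Fin m → Matrix (Fin n) (Fin n) ℝ} {η : Fin m → ℝ}

lemma CS.eta_ne (h : CS J p η) (i : Fin m) : η i ≠ 0 := by
  intro h0
  have := h.ee i
  rw [h0] at this; simp at this

lemma CS.dim_div (h : CS J p η) (k : ℕ) (hk : m = 2 * k) : 2 ^ k ∣ n := by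
  refine div_real (fun i => if hi : i < m then p ⟨i, hi⟩ else 1)
    (fun i => if hi : i < m then η ⟨i, hi⟩ else 1) ?_ ?_ ?_
  · intro i hi
    rw [← hk] at hi
    simp only [hi, dif_pos]
    exact h.eta_ne _
  · intro i hi
    rw [← hk] at hi
    simp only [hi, dif_pos]
    exact h.sq _
  · intro i hi j hj hij
    rw [← hk] at hi hj
    simp only [hi, hj, dif_pos]
    exact h.ac _ _ (by simpa using hij)

lemma CS.cancel (h : CS J p η) (j : Fin m) {X : Matrix (Fin n) (Fin n) ℝ} (hX : p j * X = 0) :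
    X = 0 := by
  have := congrArg (fun Y => η j • (p j * Y)) hX
  simpa [← Matrix.mul_assoc, h.sq, smul_smul, h.ee] using this

/-- conjugation by a Clifford element -/
def psi (p : Fin m → Matrix (Fin n) (Fin n) ℝ) (η : Fin m → ℝ) (j : Fin m) :
    Matrix (Fin n) (Fin n) ℝ →ₗ[ℝ] Matrix (Fin n) (Fin n) ℝ :=
  η j • (LinearMap.mulLeft ℝ (p j) ∘ₗ LinearMap.mulRight ℝ (p j))

lemma psi_apply (j : Fin m) (X : Matrix (Fin n) (Fin n) ℝ) :
    psi p η j X = η j • (p j * (X * p j)) := rfl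

lemma CS.psi_inv (h : CS J p η) (j : Fin m) (X : Matrix (Fin n) (Fin n) ℝ) :
    psi p η j (psi p η j X) = X := by
  rw [psi_apply, psi_apply, smul_mul_assoc, mul_smul_comm, smul_smul, h.ee, one_smul]
  calc p j * (p j * (X * p j) * p j) = (p j * p j) * X * (p j * p j) := by
        simp only [Matrix.mul_assoc]
    _ = X := by
      rw [h.sq, smul_mul_assoc, one_mul, mul_smul_comm, mul_one, smul_smul, h.ee, one_smul]

lemma CS.psi_comm (h : CS J p η) (i j : Fin m) (X : Matrix (Fin n) (Fin n) ℝ) :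
    psi p η i (psi p η j X) = psi p η j (psi p η i X) := by
  by_cases hij : i = j
  · rw [hij]
  · simp only [psi_apply, smul_mul_assoc, mul_smul_comm, smul_smul, mul_comm (η j)]
    congr 1
    calc p i * (p j * (X * p j) * p i) = (p i * p j) * X * (p j * p i) := by
          simp only [Matrix.mul_assoc]
      _ = (p j * p i) * X * (p i * p j) := by
          rw [h.ac i j hij, neg_mul, neg_mul, mul_neg]
      _ = _ := by simp only [Matrix.mul_assoc]

lemma CS.comm_of_Ps (h : CS J p η) {c : ℝ} (hc : (m:ℝ) ≤ c) {C : Matrix (Fin n) (Fin n) ℝ}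
    (hC : Ps p η C = c • C) : (∀ j, p j * C = C * p j) ∧ (C = 0 ∨ c = m) := by
  have h0 : ∑ j, psi p η j C = c • C := by
    rw [← hC, Ps]
    exact Finset.sum_congr rfl fun j _ => by rw [psi_apply, Matrix.mul_assoc]
  have h1 := spectral (psi p η) h.psi_inv h.psi_comm Finset.univ c C (by simpa using hc) h0
  refine ⟨fun j => ?_, ?_⟩
  · have := congrArg (fun Y => p j * Y) (h1 j (Finset.mem_univ j))
    simp only [psi_apply] at this
    rw [← this, mul_smul_comm, ← Matrix.mul_assoc, h.sq, smul_mul_assoc, one_mul, smul_smul,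
      h.ee, one_smul]
  · rw [Finset.sum_congr rfl h1, Finset.sum_const, Finset.card_univ, Fintype.card_fin,
      ← Nat.cast_smul_eq_nsmul ℝ, ← sub_eq_zero, ← sub_smul] at h0
    rcases smul_eq_zero.1 h0 with h2 | h2
    · right; linarith
    · left; exact h2

lemma CS.pure (h : CS J p η) (hm : 2 ≤ m) {c : Fin m → ℝ} {C : Matrix (Fin n) (Fin n) ℝ}
    (hC : ∀ j, p j * C = C * p j) {e : ℝ} (hX : (pc p c + C) * (pc p c + C) = e • 1) :
    C = 0 ∨ pc p c = 0 := by
  have hcC : pc p c * C = C * pc p c := by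
    simp [pc, Finset.sum_mul, Finset.mul_sum, hC]
  have h1 : (2:ℝ) • (pc p c * C) = (e - nsq η c) • 1 - C * C := by
    rw [add_mul, mul_add, mul_add, h.pc_sq, ← hcC] at hX
    rw [sub_smul, ← hX, two_smul]; abel
  have h2 : ∀ j, p j * (pc p c * C) = (pc p c * C) * p j := by
    intro j
    have : p j * ((2:ℝ) • (pc p c * C)) = ((2:ℝ) • (pc p c * C)) * p j := by
      rw [h1, mul_sub, sub_mul, ← Matrix.mul_assoc, hC, Matrix.mul_assoc, hC, Matrix.mul_assoc]
      simp
    rw [mul_smul_comm, smul_mul_assoc] at this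
    exact smul_right_injective _ (two_ne_zero (α := ℝ)) this
  have h3 : ∀ j, pc p c * C = c j • (p j * C) := by
    intro j
    have e1 := h2 j
    rw [Matrix.mul_assoc (pc p c), ← hC j, ← Matrix.mul_assoc, ← Matrix.mul_assoc] at e1
    have e2 : pc p c * p j = - (p j * pc p c) + (2 * η j * c j) • 1 := by
      rw [h.anti j c]; abel
    rw [e2, add_mul, neg_mul, smul_mul_assoc, one_mul] at e1
    have e3 : p j * (pc p c * C) = (η j * c j) • C := by
      rw [← Matrix.mul_assoc]
      have : (2:ℝ) • (p j * pc p c * C) = (2:ℝ) • ((η j * c j) • C) := by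
        rw [two_smul]; nth_rewrite 1 [e1]; module
      exact smul_right_injective _ (two_ne_zero (α := ℝ)) this
    have e4 := congrArg (fun Y => η j • (p j * Y)) e3
    simp only [← Matrix.mul_assoc, h.sq, smul_mul_assoc, one_mul, smul_smul, h.ee, one_smul,
      mul_smul_comm] at e4
    rw [e4, ← mul_assoc, h.ee, one_mul]
  have h4 : pc p c * C = (m:ℝ) • (pc p c * C) := by
    have : pc p c * C = ∑ j, c j • (p j * C) := by
      simp [pc, Finset.sum_mul]
    nth_rewrite 1 [this]
    rw [Finset.sum_congr rfl fun j _ => (h3 j).symm, Finset.sum_const, Finset.card_univ,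
      Fintype.card_fin, Nat.cast_smul_eq_nsmul]
  have h5 : pc p c * C = 0 := by
    have : ((m:ℝ) - 1) • (pc p c * C) = 0 := by rw [sub_smul, one_smul, ← h4, sub_self]
    refine (smul_eq_zero.1 this).resolve_left ?_
    have : (2:ℝ) ≤ m := by exact_mod_cast hm
    intro h0; linarith
  by_cases hC0 : C = 0
  · left; exact hC0
  · right
    rw [pc]
    refine Finset.sum_eq_zero fun j _ => ?_
    have e1 := h3 j
    rw [h5] at e1
    rcases smul_eq_zero.1 e1.symm with h6 | h6
    · rw [h6, zero_smul]
    · exact absurd (h.cancel j h6) hC0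

lemma CS.no_comm (h : CS J p η) {p' : Fin m → Matrix (Fin n) (Fin n) ℝ} (h' : CS J p' η)
    (hm : m % 4 = 0) (hη : ∏ j, η j = 1) (hc : ∀ k j, p j * p' k = p' k * p j) : 2 ^ m ∣ n := by
  have hme : Even m := ⟨m / 2, by omega⟩
  have hQ : ∀ k, vol p * p' k = p' k * vol p := by
    intro k
    have : ∀ w, wd p w * p' k = p' k * wd p w := by
      intro w
      induction w with
      | nil => simp [wd_nil]
      | cons i w ih => rw [wd_cons, Matrix.mul_assoc, ih, ← Matrix.mul_assoc, hc,
          Matrix.mul_assoc]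
    exact this _
  have hQQ : ∀ i j, (vol p * p' i) * (vol p * p' j) = p' i * p' j := by
    intro i j
    rw [hQ i, Matrix.mul_assoc, ← Matrix.mul_assoc (vol p), h.vol_sq hm hη, one_mul]
  have hPQ : ∀ i j, p i * (vol p * p' j) = -((vol p * p' j) * p i) := by
    intro i j
    rw [← Matrix.mul_assoc, h.vol_anti hme, neg_mul, Matrix.mul_assoc, hc, Matrix.mul_assoc]
  refine div_real (fun i => if hi : i < m then p ⟨i, hi⟩ else
      if hi : i - m < m then vol p * p' ⟨i - m, hi⟩ else 1)
    (fun i => if hi : i < m then η ⟨i, hi⟩ else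
      if hi : i - m < m then η ⟨i - m, hi⟩ else 1) ?_ ?_ ?_
  · intro i hi
    by_cases h1 : i < m
    · simp only [h1, dif_pos]; exact h.eta_ne _
    · have h2 : i - m < m := by omega
      simp only [h1, h2, dif_pos, dif_neg, not_false_eq_true]; exact h.eta_ne _
  · intro i hi
    by_cases h1 : i < m
    · simp only [h1, dif_pos]; exact h.sq _
    · have h2 : i - m < m := by omega
      simp only [h1, h2, dif_pos, dif_neg, not_false_eq_true]
      rw [hQQ]; exact h'.sq _
  · intro i hi j hj hij
    by_cases h1 : i < m <;> by_cases h3 : j < m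
    · simp only [h1, h3, dif_pos]
      exact h.ac _ _ (by simpa using hij)
    · have h4 : j - m < m := by omega
      simp only [h1, h3, h4, dif_pos, dif_neg, not_false_eq_true]
      exact hPQ _ _
    · have h2 : i - m < m := by omega
      simp only [h1, h3, h2, dif_pos, dif_neg, not_false_eq_true]
      rw [hPQ, neg_neg]
    · have h2 : i - m < m := by omega
      have h4 : j - m < m := by omega
      simp only [h1, h3, h2, h4, dif_pos, dif_neg, not_false_eq_true]
      rw [hQQ, hQQ]
      exact h'.ac _ _ (by simp only [ne_eq, Fin.mk.injEq]; omega)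

lemma CS.in_span (h : CS J p η) {p' : Fin m → Matrix (Fin n) (Fin n) ℝ} (h' : CS J p' η)
    (hq : qH J p η = qH J p' η) {l : ℕ} (hn : n = 2 * l) (hm2 : 2 ≤ m) (hm : m % 4 = 0)
    (hlm : m < l) (hη : ∏ j, η j = 1) : ∃ a : Fin m → Fin m → ℝ, ∀ k, p' k = pc p (a k) := by
  obtain ⟨t, ht⟩ : ∃ t, m = 4 * t := ⟨m / 4, by omega⟩
  have hl2 : 8 * t ≤ l + 2 := by
    have := h.dim_div (2 * t) (by omega)
    rw [hn] at this
    exact num_two (by omega) this (by omega)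
  have hlR : (2 * m : ℝ) ≤ l + 2 := by
    have : 2 * m ≤ l + 2 := by omega
    exact_mod_cast this
  have hnR : (n:ℝ) = 2 * l := by rw [hn]; push_cast; ring
  have hn0 : 0 < n := by omega
  have main : ∀ k, (∃ c, p' k = pc p c) ∨ ((∀ j, p j * p' k = p' k * p j) ∧ l + 2 = 2 * m) := by
    intro k
    have h1 : Th p η (p' k) = (n + 4 - 2 * m : ℝ) • p' k := by
      rw [h.Th_inv h' hq (h'.sym k), h'.Th_self]
    obtain ⟨c, C, hX, hC⟩ := h.Th_split hn0 h1
    obtain ⟨hcomm, hz⟩ := h.comm_of_Ps (by rw [hnR]; linarith) hC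
    have hsq := h'.sq k
    rw [hX] at hsq
    rcases h.pure hm2 hcomm hsq with h0 | h0
    · left; exact ⟨c, by rw [hX, h0, add_zero]⟩
    · rcases hz with h2 | h2
      · left; exact ⟨c, by rw [hX, h2, add_zero]⟩
      · right
        rw [h0, zero_add] at hX
        rw [hX]
        refine ⟨hcomm, ?_⟩
        rw [hnR] at h2
        have : (l:ℝ) + 2 = 2 * m := by linarith
        exact_mod_cast this
  by_cases hall : ∀ k, ∃ c, p' k = pc p c
  · choose a ha using hall
    exact ⟨a, ha⟩
  · exfalso
    push Not at hall
    obtain ⟨k0, hk0⟩ := hall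
    have hk := (main k0).resolve_left (by push Not; exact hk0)
    have hcc : ∀ k j, p j * p' k = p' k * p j := by
      intro k
      rcases main k with ⟨c, hc⟩ | hc
      · exfalso
        have hne : k ≠ k0 := by rintro rfl; exact hk0 c hc
        have e1 : p' k * p' k0 = p' k0 * p' k := by
          rw [hc]; simp [pc, Finset.sum_mul, Finset.mul_sum, hk.1]
        have e2 := h'.ac k k0 hne
        rw [← e1] at e2
        have e4 : p' k * p' k0 = 0 := by
          ext u v
          have := congrFun (congrFun e2 u) v
          simp only [Matrix.neg_apply] at this
          rw [Matrix.zero_apply]; linarith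
        have e3 := h'.cancel _ e4
        exact hk0 0 (by rw [e3]; simp [pc])
      · exact hc.1
    have hd := Nat.le_of_dvd hn0 (h.no_comm h' hm hη hcc)
    have := num_three (m := m) (by omega)
    omega

end SpanPart


section Final

variable {n m : ℕ} {J : Matrix (Fin n) (Fin n) ℝ}
    {p : Fin m → Matrix (Fin n) (Fin n) ℝ} {η : Fin m → ℝ}

lemma CS.no_eig (h : CS J p η) {l : ℕ} (hn : n = 2 * l) (hm2 : 2 ≤ m) (hm : m % 4 = 0)
    (hlm : m < l) (hη : ∏ j, η j = 1) {x0 : Fin n → ℝ} (hx0 : x0 ∈ Mset J p) {c : ℝ}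
    (hc : ∀ y ∈ connectedComponentIn (Mset J p) x0, bB J (vol p *ᵥ y) y = c) : False := by
  have hme : Even m := ⟨m / 2, by omega⟩
  have hxL : x0 ∈ connectedComponentIn (Mset J p) x0 := mem_connectedComponentIn hx0
  have hQs := h.vol_sym hm
  have hQQ := h.vol_sq hm hη
  have hRs : (vol p - c • 1)ᵀ * J = J * (vol p - c • 1) := by
    simp [sub_mul, mul_sub, hQs]
  have hR : ∀ y ∈ connectedComponentIn (Mset J p) x0, bB J ((vol p - c • 1) *ᵥ y) y = 0 := by
    intro y hy
    rw [Matrix.sub_mulVec, Matrix.smul_mulVec, Matrix.one_mulVec, map_sub, LinearMap.sub_apply,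
      map_smul, LinearMap.smul_apply, hc y hy, (mem_L hy).1]
    simp
  have hperp : ∀ x j, bB J (p j *ᵥ x) (vol p *ᵥ x) = 0 := by
    intro x j
    have : bB J (p j *ᵥ x) (vol p *ᵥ x) = - bB J (p j *ᵥ x) (vol p *ᵥ x) := by
      nth_rewrite 1 [bB_adj (h.sym j)]
      rw [Matrix.mulVec_mulVec, h.vol_anti hme, Matrix.neg_mulVec, map_neg,
        ← Matrix.mulVec_mulVec, ← bB_adj hQs, bB_symm h.JT (vol p *ᵥ x)]
    linarith
  have heig : ∀ y ∈ connectedComponentIn (Mset J p) x0, (vol p - c • 1) *ᵥ y = 0 := by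
    intro y hy
    rw [h.normal hRs hR hy, pc_mulVec]
    refine Finset.sum_eq_zero fun j _ => ?_
    rw [Matrix.sub_mulVec, Matrix.smul_mulVec, Matrix.one_mulVec, map_sub, hperp, map_smul,
      (mem_L hy).2]
    simp
  have heig' : ∀ v, (vol p - c • 1) *ᵥ v = 0 → vol p *ᵥ v = c • v := by
    intro v hv
    rwa [Matrix.sub_mulVec, Matrix.smul_mulVec, Matrix.one_mulVec, sub_eq_zero] at hv
  have hx1 := heig' _ (heig x0 hxL)
  have hc2 : c * c = 1 := by
    have e1 : vol p *ᵥ (vol p *ᵥ x0) = x0 := by rw [Matrix.mulVec_mulVec, hQQ, Matrix.one_mulVec]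
    rw [hx1, Matrix.mulVec_smul, hx1, smul_smul] at e1
    have e2 := congrArg (fun z => bB J z x0) e1
    simpa [hx0.1] using e2
  have hc0 : c ≠ 0 := by rintro rfl; simp at hc2
  -- tangent vectors are eigenvectors
  have htan : ∀ v, bB J x0 v = 0 → (∀ j, bB J (p j *ᵥ x0) v = 0) → vol p *ᵥ v = c • v := by
    intro v hv hv'
    obtain ⟨γ, h0, hd, he⟩ := h.curve hxL hv hv'
    have h1 := (Matrix.toLin' (vol p - c • 1)).toContinuousLinearMap.hasFDerivAt.comp_hasDerivAt
      (0:ℝ) hd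
    have h2 : HasDerivAt ((Matrix.toLin' (vol p - c • 1)).toContinuousLinearMap ∘ γ) 0 0 := by
      have hcst : HasDerivAt (fun _ : ℝ => (0 : Fin n → ℝ)) 0 0 := hasDerivAt_const _ _
      refine hcst.congr_of_eventuallyEq ?_
      filter_upwards [he] with t ht
      exact heig _ ht
    exact heig' _ (h1.unique h2)
  -- dimension count
  let E : Submodule ℝ (Fin n → ℝ) := LinearMap.ker (Matrix.toLin' (vol p + c • 1))
  let F : Submodule ℝ (Fin n → ℝ) := LinearMap.ker (Matrix.toLin' (vol p - c • 1))
  have hE : ∀ v ∈ E, vol p *ᵥ v = -(c • v) := by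
    intro v hv
    have : (vol p + c • 1) *ᵥ v = 0 := hv
    rwa [Matrix.add_mulVec, Matrix.smul_mulVec, Matrix.one_mulVec, add_eq_zero_iff_eq_neg] at this
  have hEle : Module.finrank ℝ E ≤ m := by
    let g : E →ₗ[ℝ] (Fin m → ℝ) := (LinearMap.pi fun j => bB J (p j *ᵥ x0)) ∘ₗ E.subtype
    have hg : Function.Injective g := by
      rw [← LinearMap.ker_eq_bot, eq_bot_iff]
      intro v hv
      have hv1 : ∀ j, bB J (p j *ᵥ x0) v = 0 := fun j => congrFun hv j
      have hv2 := hE v v.2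
      have hv3 : bB J x0 v = 0 := by
        have e1 := bB_adj hQs x0 v
        rw [hx1, hv2, map_smul, LinearMap.smul_apply, map_neg, map_smul, smul_eq_mul] at e1
        have e2 : c * bB J x0 v = 0 := by linarith
        exact (mul_eq_zero.1 e2).resolve_left hc0
      have hv4 := htan v hv3 hv1
      rw [hv2] at hv4
      have e5 : (2 * c) • (v : Fin n → ℝ) = 0 := by
        rw [two_mul, add_smul]; nth_rewrite 1 [← hv4]; simp
      have e6 := (smul_eq_zero.1 e5).resolve_left (by simp [hc0])
      exact Subtype.ext e6
    simpa using LinearMap.finrank_le_finrank_of_injective hg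
  let j0 : Fin m := ⟨0, by omega⟩
  have hFE : Module.finrank ℝ F ≤ Module.finrank ℝ E := by
    refine LinearMap.finrank_le_finrank_of_injective
      (f := (Matrix.toLin' (p j0)).restrict (p := F) (q := E) ?_) ?_
    · intro v hv
      have hv1 := heig' v hv
      change (vol p + c • 1) *ᵥ (p j0 *ᵥ v) = 0
      rw [Matrix.add_mulVec, Matrix.smul_mulVec, Matrix.one_mulVec, Matrix.mulVec_mulVec,
        ← neg_neg (vol p * p j0), ← h.vol_anti hme, Matrix.neg_mulVec, ← Matrix.mulVec_mulVec,
        hv1, Matrix.mulVec_smul, neg_add_cancel]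
    · intro v w hvw
      have e1 : p j0 *ᵥ (v : Fin n → ℝ) = p j0 *ᵥ (w : Fin n → ℝ) := congrArg Subtype.val hvw
      have e2 := congrArg (fun z => p j0 *ᵥ z) e1
      simp only [Matrix.mulVec_mulVec, h.sq, Matrix.smul_mulVec, Matrix.one_mulVec] at e2
      exact Subtype.ext (smul_right_injective _ (h.eta_ne j0) e2)
  have hrange : LinearMap.range (Matrix.toLin' (vol p - c • 1)) ≤ E := by
    rintro _ ⟨v, rfl⟩
    change (vol p + c • 1) *ᵥ ((vol p - c • 1) *ᵥ v) = 0
    have e : (vol p + c • 1) * (vol p - c • 1) = 0 := by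
      rw [add_mul, mul_sub, mul_sub, hQQ]
      simp [smul_smul, hc2]
    rw [Matrix.mulVec_mulVec, e, Matrix.zero_mulVec]
  have hrk := LinearMap.finrank_range_add_finrank_ker (Matrix.toLin' (vol p - c • 1))
  have hr1 := Submodule.finrank_mono hrange
  have hnn : Module.finrank ℝ (Fin n → ℝ) = n := by simp
  rw [hnn] at hrk
  change _ + Module.finrank ℝ F = n at hrk
  omega

lemma CS.final (h : CS J p η) {l : ℕ} (hn : n = 2 * l) (hm2 : 2 ≤ m) (hm : m % 4 = 0)
    (hlm : m < l) (hη : ∏ j, η j = 1) {x0 : Fin n → ℝ} (hx0 : x0 ∈ Mset J p)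
    (K : Set (Matrix (Fin n) (Fin n) ℝ))
    (hK1 : ∀ A ∈ K, Aᵀ * J * A = J)
    (hK2 : ∀ A ∈ K, ∃ B ∈ K, A * B = 1 ∧ B * A = 1)
    (hK3 : ∀ A ∈ K, ∀ x ∈ connectedComponentIn (Mset J p) x0,
      A *ᵥ x ∈ connectedComponentIn (Mset J p) x0)
    (hK4 : ∀ x ∈ connectedComponentIn (Mset J p) x0, ∀ y ∈ connectedComponentIn (Mset J p) x0,
      ∃ A ∈ K, A *ᵥ x = y) : False := by
  have hxL : x0 ∈ connectedComponentIn (Mset J p) x0 := mem_connectedComponentIn hx0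
  have hsp : ∀ A ∈ K, ∀ B ∈ K, A * B = 1 → B * A = 1 →
      ∃ a : Fin m → Fin m → ℝ, ∀ k, B * p k * A = pc p (a k) := by
    intro A hA B hB h1 h2
    exact h.in_span (h.conj (hK1 A hA) h1 h2)
      (h.qH_inv (hK1 A hA) h1 h2 hx0 (hK3 A hA) (hK3 B hB)) hn hm2 hm hlm hη
  have hsq : ∀ y ∈ connectedComponentIn (Mset J p) x0,
      (bB J (vol p *ᵥ y) y) ^ 2 = (bB J (vol p *ᵥ x0) x0) ^ 2 := by
    intro y hy
    obtain ⟨A, hA, rfl⟩ := hK4 x0 hxL y hy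
    obtain ⟨B, hB, h1, h2⟩ := hK2 A hA
    obtain ⟨a, ha⟩ := hsp A hA B hB h1 h2
    obtain ⟨b, hb⟩ := hsp B hB A hA h2 h1
    obtain ⟨e, he, hv⟩ := h.vol_conj (by omega) hm hη h1 h2 ha hb
    rw [← bB_O (hK1 A hA) h1, hv, Matrix.smul_mulVec, map_smul, LinearMap.smul_apply,
      smul_eq_mul, mul_pow, he, one_mul]
  have hconst : ∃ c, ∀ y ∈ connectedComponentIn (Mset J p) x0, bB J (vol p *ᵥ y) y = c := by
    by_cases hd : bB J (vol p *ᵥ x0) x0 = 0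
    · refine ⟨0, fun y hy => ?_⟩
      have := hsq y hy
      rw [hd] at this
      simpa using this
    · have := IsPreconnected.eq_or_eq_neg_of_sq_eq
        (isPreconnected_connectedComponentIn (F := Mset J p) (x := x0))
        (f := fun y => bB J (vol p *ᵥ y) y) (g := fun _ => bB J (vol p *ᵥ x0) x0)
        (cont_bB (vol p)).continuousOn continuousOn_const
        (fun y hy => hsq y hy) (fun _ => hd)
      rcases this with h1 | h1
      · exact ⟨_, fun y hy => h1 hy⟩
      · exact ⟨_, fun y hy => h1 hy⟩
  obtain ⟨c, hc⟩ := hconst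
  exact h.no_eig hn hm2 hm hlm hη hx0 hc

end Final

lemma prod_eta (m r : ℕ) (hr : r ≤ m) (hr2 : r % 2 = 0) :
    ∏ j : Fin m, cliffEta r (j + 1) (j + 1) = 1 := by
  rw [Fin.prod_univ_eq_prod_range (fun j => cliffEta r (j + 1) (j + 1)) m,
    ← Finset.prod_range_mul_prod_Ico _ hr]
  have e1 : ∏ k ∈ Finset.range r, cliffEta r (k + 1) (k + 1) = 1 := by
    rw [Finset.prod_congr rfl (g := fun _ => (-1:ℝ)), Finset.prod_const, Finset.card_range,
      Even.neg_one_pow ⟨r / 2, by omega⟩]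
    intro k hk
    have : k + 1 ≤ r := Finset.mem_range.1 hk
    simp [cliffEta, this]
  rw [e1, one_mul]
  refine Finset.prod_eq_one fun k hk => ?_
  have : ¬ (k + 1 ≤ r) := by have := (Finset.mem_Ico.1 hk).1; omega
  simp [cliffEta, this]

lemma psJ_sq (n s : ℕ) : psJ n s * psJ n s = 1 := by
  rw [psJ, Matrix.diagonal_mul_diagonal, ← Matrix.diagonal_one]
  congr 1
  funext i
  split_ifs <;> norm_num

lemma CS_of {l s m r : ℕ} {P : ℕ → Matrix (Fin (2 * l)) (Fin (2 * l)) ℝ}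
    (hP : IsCliffordSystem l s m r P) :
    CS (psJ (2 * l) s) (fun j : Fin m => P (j + 1)) (fun j => cliffEta r (j + 1) (j + 1)) where
  JJ := psJ_sq _ _
  JT := by simp [psJ]
  ee i := by
    simp only [cliffEta, if_true]
    split_ifs <;> norm_num
  sym i := by
    rw [hP.1 _ (Finset.mem_Icc.2 ⟨by omega, by omega⟩), Matrix.mul_assoc, psJ_sq, mul_one]
  sq i := by
    have hi : (i : ℕ) + 1 ∈ Finset.Icc 1 m := Finset.mem_Icc.2 ⟨by omega, by omega⟩
    have := hP.2 _ hi _ hi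
    rw [← two_smul ℝ, mul_smul] at this
    exact smul_right_injective _ (two_ne_zero (α := ℝ)) this
  ac i j hij := by
    have := hP.2 _ (Finset.mem_Icc.2 ⟨by omega, by omega⟩ : (i : ℕ) + 1 ∈ Finset.Icc 1 m)
      _ (Finset.mem_Icc.2 ⟨by omega, by omega⟩ : (j : ℕ) + 1 ∈ Finset.Icc 1 m)
    have hne : (i : ℕ) + 1 ≠ j + 1 := fun h => hij (Fin.ext (by omega))
    simp only [cliffEta, hne, if_false, mul_zero, zero_smul] at this
    exact eq_neg_of_add_eq_zero_left this


/-- for a Clifford system of signature `(m, r)` on `ℝ^{2l}_s` with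
`m ≡ 0 (mod 4)`, `r ≡ 0 (mod 2)`, `s ≤ 2l - 1`, and `l > m`, each connected component
of the focal variety `M₊` is inhomogeneous. -/
theorem Mplus_component_inhomogeneous (l s m r : ℕ) (hl : 0 < l) (hs : s ≤ 2 * l - 1)
    (hm : 2 ≤ m) (hm4 : m % 4 = 0) (hr : r ≤ m) (hr2 : r % 2 = 0) (hlm : m < l)
    (P : ℕ → Matrix (Fin (2 * l)) (Fin (2 * l)) ℝ)
    (hP : IsCliffordSystem l s m r P)
    (Mp : Set (Fin (2 * l) → ℝ))
    (hMp : Mp = {x | psInner (2 * l) s x x = 1 ∧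
      ∀ j ∈ Finset.Icc 1 m, psInner (2 * l) s (P j *ᵥ x) x = 0}) :
    ∀ x₀ ∈ Mp, ¬ IsHomogeneousIn (2 * l) s (connectedComponentIn Mp x₀) := by
  have hM : Mp = Mset (psJ (2 * l) s) (fun j : Fin m => P (j + 1)) := by
    rw [hMp]
    ext x
    simp only [Mset, Set.mem_setOf_eq, bB_apply, psInner]
    refine and_congr_right fun _ => ⟨fun h j => h _ (Finset.mem_Icc.2 ⟨by omega, by omega⟩), ?_⟩
    intro h j hj
    rw [Finset.mem_Icc] at hj
    have := h ⟨j - 1, by omega⟩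
    simpa [Nat.sub_add_cancel hj.1] using this
  rintro x₀ hx₀ ⟨K, k1, -, -, k4, k5, k6⟩
  rw [hM] at hx₀ k5 k6
  exact (CS_of hP).final rfl hm hm4 hlm (prod_eta m r hr hr2) hx₀ K k1 k4 k5 k6
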